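/- Let X be a shift space over a finite alphabet with language 𝓛 = 𝓛(X), and let φ : X → ℝ be continuous. Suppose there is 𝓖 ⊂ 𝓛 having (W)-specification and that 𝓛 is edit approachable by 𝓖. Then for any continuous ψ : X → ℝ, either the irregular set X̂(ψ) = {x ∈ X : lim_{n→∞} (1/n)∑_{i=0}^{n−1} ψ(σ^i x) does not exist} is empty, or P_{X̂(ψ)}(φ) = P_X(φ). -/

import Mathlib

open MeasureTheory Filter Topology Set
open scoped ENNReal Classical

namespace Paper

variable {A : Type} [Fintype A] [DecidableEq A] [TopologicalSpace A] [DiscreteTopology A]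
  [MeasurableSpace A] [BorelSpace A]

/-- The left shift map on the full shift `A^ℕ`. -/
def shift : (ℕ → A) → (ℕ → A) := fun x i => x (i + 1)

/-- The cylinder set of a finite word `w`: points whose initial word is `w`. -/
def cylinder (w : List A) : Set (ℕ → A) := {x | ∀ i : Fin w.length, x i = w.get i}

/-- The language of `X`: finite words `w` with `[w] ∩ X ≠ ∅`. -/
def language (X : Set (ℕ → A)) : Set (List A) := {w | (cylinder w ∩ X).Nonempty}

/-- One edit of a word: a substitution, an insertion, or a deletion. -/
def EditStep (w w' : List A) : Prop :=
  (∃ u₁ u₂ : List A, ∃ a a' : A, w = u₁ ++ [a] ++ u₂ ∧ w' = u₁ ++ [a'] ++ u₂) ∨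
  (∃ u₁ u₂ : List A, ∃ a' : A, w = u₁ ++ u₂ ∧ w' = u₁ ++ [a'] ++ u₂) ∨
  (∃ u₁ u₂ : List A, ∃ a : A, w = u₁ ++ [a] ++ u₂ ∧ w' = u₁ ++ u₂)

/-- The edit distance: the minimal number of edits transforming `v` into `w`. -/
noncomputable def editDist (v w : List A) : ℕ :=
  sInf {n | ∃ f : ℕ → List A, f 0 = v ∧ f n = w ∧ ∀ i < n, EditStep (f i) (f (i + 1))}

/-- `G ⊆ L` has (W)-specification (with some gap length `τ`). -/
def HasSpecW (L G : Set (List A)) : Prop :=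
  ∃ τ : ℕ, ∀ v ∈ G, ∀ w ∈ G, ∃ u ∈ L, u.length ≤ τ ∧ v ++ u ++ w ∈ G

/-- A mistake function: nondecreasing with `g n / n → 0`. -/
def MistakeFun (g : ℕ → ℕ) : Prop :=
  Monotone g ∧ Tendsto (fun n => (g n : ℝ) / n) atTop (𝓝 0)

/-- `L` is edit approachable by `G`. -/
def EditApproachable (L G : Set (List A)) : Prop :=
  ∃ g : ℕ → ℕ, MistakeFun g ∧ ∀ w ∈ L, ∃ v ∈ G, editDist v w ≤ g w.length

/-- The shift map restricted to a (shift-invariant) subset `X`, as a self-map of `↥X`. -/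
noncomputable def subShift (X : Set (ℕ → A)) : ↥X → ↥X := fun x =>
  if h : shift x.val ∈ X then ⟨shift x.val, h⟩ else x

/-- Birkhoff sum `S_n φ = ∑_{i<n} φ ∘ σ^i`. -/
def birkhoff {Y : Type*} (σ : Y → Y) (φ : Y → ℝ) (n : ℕ) (y : Y) : ℝ :=
  ∑ i ∈ Finset.range n, φ (σ^[i] y)

/-- The Birkhoff average `(1/n) S_n φ`. -/
noncomputable def birkAvg {Y : Type*} (σ : Y → Y) (φ : Y → ℝ) (n : ℕ) (y : Y) : ℝ :=
  (n : ℝ)⁻¹ * birkhoff σ φ n y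

/-- Carathéodory sum `M(Z,t,φ,N)` over covers of `Z` by cylinders of length `> N`. -/
noncomputable def Mcal (X : Set (ℕ → A)) (φ : ↥X → ℝ) (Z : Set ↥X) (t : ℝ) (N : ℕ) : ℝ≥0∞ :=
  ⨅ (S : Set (List A)) (_ : S.Countable) (_ : ∀ w ∈ S, N < w.length)
    (_ : Z ⊆ ⋃ w ∈ S, Subtype.val ⁻¹' cylinder w),
    ∑' w : S, ENNReal.ofReal (Real.exp (-t * (w : List A).length +
      sSup (birkhoff (subShift X) φ (w : List A).length ''
        (Subtype.val ⁻¹' cylinder (w : List A)))))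

/-- `M(Z,t,φ) = lim_{N→∞} M(Z,t,φ,N)` (the limit of a nondecreasing quantity). -/
noncomputable def McalLim (X : Set (ℕ → A)) (φ : ↥X → ℝ) (Z : Set ↥X) (t : ℝ) : ℝ≥0∞ :=
  ⨆ N : ℕ, Mcal X φ Z t N

/-- The topological pressure `P_Z(φ)` of `Z ⊆ X`. -/
noncomputable def pressure (X : Set (ℕ → A)) (φ : ↥X → ℝ) (Z : Set ↥X) : ℝ :=
  sInf {t : ℝ | McalLim X φ Z t = 0}

/-- The empirical measure `ℰ_n(x) = (1/n) ∑_{i<n} δ_{σ^i x}`. -/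
noncomputable def empiric {Y : Type*} [MeasurableSpace Y] (σ : Y → Y) (n : ℕ) (x : Y) :
    Measure Y := (n : ℝ≥0∞)⁻¹ • ∑ i ∈ Finset.range n, Measure.dirac (σ^[i] x)

/-- The set `A(ℰ_n(x))` of weak* limit points of the sequence of empirical measures of `x`:
probability measures that are limits of the empirical measures along a subsequence. -/
def limitPts {Y : Type*} [MeasurableSpace Y] [TopologicalSpace Y] (σ : Y → Y) (x : Y) :
    Set (ProbabilityMeasure Y) :=
  {μ | ∃ φ : ℕ → ℕ, StrictMono φ ∧ ∀ f : C(Y, ℝ),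
      Tendsto (fun k => birkAvg σ (fun y => f y) (φ k) x) atTop (𝓝 (∫ y, f y ∂μ.toMeasure))}

/-- The saturated set `G_K = {x : A(ℰ_n(x)) = K}`. -/
def saturated {Y : Type*} [MeasurableSpace Y] [TopologicalSpace Y] (σ : Y → Y)
    (K : Set (ProbabilityMeasure Y)) : Set Y := {x | limitPts σ x = K}

/-- The generic points of `μ`: those `x` with `ℰ_n(x) → μ` in the weak* topology. -/
def genericPts {Y : Type*} [MeasurableSpace Y] [TopologicalSpace Y] (σ : Y → Y)
    (μ : ProbabilityMeasure Y) : Set Y :=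
  {x | ∀ f : C(Y, ℝ),
      Tendsto (fun n => birkAvg σ (fun y => f y) n x) atTop (𝓝 (∫ y, f y ∂μ.toMeasure))}

/-- `μ` is a `σ`-invariant (probability) measure. -/
def IsInvariant {Y : Type*} [MeasurableSpace Y] (σ : Y → Y) (μ : ProbabilityMeasure Y) : Prop :=
  μ.toMeasure.map σ = μ.toMeasure

/-- The level set `X(ψ,α)` of points whose Birkhoff averages of `ψ` converge to `α`. -/
def levelSet {Y : Type*} (σ : Y → Y) (ψ : Y → ℝ) (α : ℝ) : Set Y :=
  {x | Tendsto (fun n => birkAvg σ ψ n x) atTop (𝓝 α)}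

/-- The irregular set `X̂(ψ)` of points whose Birkhoff averages of `ψ` do not converge. -/
def irregular {Y : Type*} (σ : Y → Y) (ψ : Y → ℝ) : Set Y :=
  {x | ¬ ∃ α : ℝ, Tendsto (fun n => birkAvg σ ψ n x) atTop (𝓝 α)}

/-- The cylinder of a word of length `n` given as `w : Fin n → A`. -/
def cylF {n : ℕ} (w : Fin n → A) : Set (ℕ → A) := {x | ∀ i : Fin n, x i = w i}

/-- The entropy `H_n(μ)` of the partition of `X` into cylinders of length `n`. -/
noncomputable def wordEntropy (X : Set (ℕ → A)) (μ : ProbabilityMeasure ↥X) (n : ℕ) : ℝ :=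
  ∑ w : Fin n → A, Real.negMulLog ((μ.toMeasure (Subtype.val ⁻¹' cylF w)).toReal)

/-- The measure-theoretic (Kolmogorov–Sinai) entropy `h_μ(σ)` of a shift-invariant measure on a
subshift: by subadditivity, `lim_n H_n/n = inf_{n ≥ 1} H_n/n`. -/
noncomputable def entropy (X : Set (ℕ → A)) (μ : ProbabilityMeasure ↥X) : ℝ :=
  ⨅ n : ℕ, wordEntropy X μ (n + 1) / (n + 1)

/-- The distance `D` on measures induced by a countable family of continuous functions. -/
noncomputable def Dmetric {Y : Type*} [MeasurableSpace Y] [TopologicalSpace Y]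
    (f : ℕ → C(Y, ℝ)) (μ ν : Measure Y) : ℝ :=
  ∑' k : ℕ, ((2 : ℝ) ^ (k + 1))⁻¹ * |(∫ y, f k y ∂μ) - ∫ y, f k y ∂ν|

/-- The family `f` is separating: `D` separates Borel probability measures. -/
def Separating {Y : Type*} [MeasurableSpace Y] [TopologicalSpace Y] (f : ℕ → C(Y, ℝ)) : Prop :=
  ∀ μ ν : ProbabilityMeasure Y,
    (∀ k, (∫ y, f k y ∂μ.toMeasure) = ∫ y, f k y ∂ν.toMeasure) → μ = ν

/-- Diameter of a set with respect to a distance function `d`, valued in `ℝ≥0∞`. -/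
noncomputable def ediam {Y : Type*} (d : Y → Y → ℝ) (U : Set Y) : ℝ≥0∞ :=
  ⨆ x ∈ U, ⨆ y ∈ U, ENNReal.ofReal (d x y)

/-- The `s`-dimensional Hausdorff pre-measure at scale `ε` w.r.t. the distance `d`. -/
noncomputable def hMeasAux {Y : Type*} (d : Y → Y → ℝ) (s : ℝ) (ε : ℝ≥0∞) (Z : Set Y) : ℝ≥0∞ :=
  ⨅ (C : ℕ → Set Y) (_ : Z ⊆ ⋃ n, C n) (_ : ∀ n, ediam d (C n) ≤ ε),
    ∑' n, ⨆ (_ : (C n).Nonempty), ediam d (C n) ^ s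

/-- The `s`-dimensional Hausdorff measure w.r.t. the distance `d`. -/
noncomputable def hMeas {Y : Type*} (d : Y → Y → ℝ) (s : ℝ) (Z : Set Y) : ℝ≥0∞ :=
  ⨆ (ε : ℝ≥0∞) (_ : 0 < ε), hMeasAux d s ε Z

/-- The Hausdorff dimension of `Z` w.r.t. the distance `d`. -/
noncomputable def hdim {Y : Type*} (d : Y → Y → ℝ) (Z : Set Y) : ℝ :=
  sInf {s : ℝ | 0 ≤ s ∧ hMeas d s Z = 0}

/-- The length `|x ∧ y|` of the longest common prefix of two distinct points. -/
noncomputable def wedge (x y : ℕ → A) : ℕ := sInf {n | x n ≠ y n}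

/-- The Gatzouras–Peres distance `d_φ` associated with a strictly positive continuous `φ`. -/
noncomputable def dphi (X : Set (ℕ → A)) (φ : ↥X → ℝ) (x y : ↥X) : ℝ :=
  if x = y then 0
  else Real.exp (-(sSup (birkhoff (subShift X) φ (wedge x.val y.val) ''
      {z : ↥X | ∀ i < wedge x.val y.val, z.val i = x.val i})))

/-- The word `w` occurs in `x` at position `k`. -/
def occursAt (w : List A) (x : ℕ → A) (k : ℕ) : Prop :=
  ∀ i : Fin w.length, x (k + i) = w.get i

/-- A shift of finite type: determined by a finite set of forbidden words. -/
def IsSFT {B : Type} (Z : Set (ℕ → B)) : Prop :=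
  ∃ F : Set (List B), F.Finite ∧ Z = {x | ∀ w ∈ F, ∀ k, ¬ occursAt w x k}

/-- A sofic shift: the image of a shift of finite type under a sliding block code. -/
def IsSofic (Y : Set (ℕ → A)) : Prop :=
  ∃ (B : Type) (_ : Fintype B) (Z : Set (ℕ → B)) (π : (ℕ → B) → (ℕ → A)),
    IsSFT Z ∧ Set.MapsTo shift Z Z ∧
    (∃ r : ℕ, ∀ z ∈ Z, ∀ z' ∈ Z, ∀ k, (∀ i ≤ k + r, z i = z' i) → π z k = π z' k) ∧
    (∀ z ∈ Z, π (shift z) = shift (π z)) ∧ π '' Z = Y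

/-- Topological transitivity of a subshift, via its language. -/
def IsTransitive (Y : Set (ℕ → A)) : Prop :=
  ∀ u ∈ language Y, ∀ v ∈ language Y, ∃ w : List A, u ++ w ++ v ∈ language Y

/-- The prefix of length `n` of `x`, as a word. -/
def prefixWord (x : ℕ → A) (n : ℕ) : List A := List.ofFn fun i : Fin n => x i

/-- The norm `‖m‖ = sup_{0 < ‖f‖ ≤ 1} |∫ f dm| / ‖f‖` of a measure on a compact space. -/
noncomputable def mnorm {Y : Type*} [TopologicalSpace Y] [CompactSpace Y] [MeasurableSpace Y]
    (m : Measure Y) : ℝ :=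
  sSup ((fun f : C(Y, ℝ) => |∫ y, f y ∂m| / ‖f‖) '' {f : C(Y, ℝ) | 0 < ‖f‖ ∧ ‖f‖ ≤ 1})

/-- Strict lexicographic order on `ℕ`-indexed sequences of naturals. -/
def lexLt (x y : ℕ → ℕ) : Prop := ∃ n : ℕ, (∀ i < n, x i = y i) ∧ x n < y n

/-- The β-shift: all sequences over `{0, …, b-1}` all of whose shifts are lexicographically
below the expansion `w` of `1` in base `β` (where `b = ⌈β⌉`). -/
def betaShift (b : ℕ) (w : ℕ → ℕ) : Set (ℕ → Fin b) :=
  {x | ∀ j : ℕ, 1 ≤ j → lexLt (fun i => ((shift^[j] x) i : ℕ)) w}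

/-- The S-gap shift: sequences over `{0,1}` such that the number of `0`s between any two
consecutive `1`s lies in `S`. -/
def sGapShift (S : Set ℕ) : Set (ℕ → Fin 2) :=
  {x | ∀ k l : ℕ, k < l → x k = 1 → x l = 1 →
    (∀ m : ℕ, k < m → m < l → x m = 0) → l - k - 1 ∈ S}

/-! ### Cylinders and Birkhoff sums -/

lemma shift_iterate_apply {α : Type} (n : ℕ) (x : ℕ → α) (i : ℕ) :
    (shift^[n] x) i = x (i + n) := by
  induction n generalizing x with
  | zero => rfl
  | succ n ih =>
    rw [Function.iterate_succ_apply, ih]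
    exact congrArg x (by ring)

lemma subShift_iterate_val {α : Type} {X : Set (ℕ → α)} (hX : MapsTo shift X X) (n : ℕ) (x : X) :
    ((subShift X)^[n] x).val = shift^[n] x.val := by
  induction n generalizing x with
  | zero => rfl
  | succ n ih =>
    rw [Function.iterate_succ_apply, Function.iterate_succ_apply, ih]
    simp [subShift, hX x.2]

lemma mem_cylinder_iff {α : Type} {w : List α} {x : ℕ → α} :
    x ∈ cylinder w ↔ ∀ (i : ℕ) (h : i < w.length), x i = w[i] := by
  simp only [cylinder, mem_ofPred_eq, List.get_eq_getElem]
  exact ⟨fun h i hi => h ⟨i, hi⟩, fun h i => h i i.2⟩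

lemma mem_cylinder_append {α : Type} {u v : List α} {x : ℕ → α} :
    x ∈ cylinder (u ++ v) ↔ x ∈ cylinder u ∧ shift^[u.length] x ∈ cylinder v := by
  simp only [mem_cylinder_iff, shift_iterate_apply]
  constructor
  · intro h
    refine ⟨fun i hi => ?_, fun i hi => ?_⟩
    · rw [h i (by simp; omega), List.getElem_append_left hi]
    · rw [h (i + u.length) (by simp; omega), List.getElem_append_right (by omega)]
      simp
  · rintro ⟨h1, h2⟩ i hi
    by_cases hu : i < u.length
    · rw [h1 i hu, List.getElem_append_left hu]
    · have h3 := h2 (i - u.length) (by simp at hi; omega)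
      rw [List.getElem_append_right (by omega), ← h3]
      congr 1
      omega

lemma mem_cylinder_cons {α : Type} {a : α} {v : List α} {x : ℕ → α} :
    x ∈ cylinder (a :: v) ↔ x 0 = a ∧ shift x ∈ cylinder v := by
  rw [← List.singleton_append, mem_cylinder_append]
  simp [mem_cylinder_iff (w := [a])]

lemma length_prefixWord {α : Type} (x : ℕ → α) (n : ℕ) : (prefixWord x n).length = n := by
  simp [prefixWord]

lemma mem_cylinder_prefixWord {α : Type} (x : ℕ → α) (n : ℕ) : x ∈ cylinder (prefixWord x n) := by
  rw [mem_cylinder_iff]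
  intro i hi
  simp [prefixWord]

lemma prefixWord_mem_language {α : Type} {X : Set (ℕ → α)} (x : X) (n : ℕ) :
    prefixWord x.val n ∈ language X :=
  ⟨x.val, mem_cylinder_prefixWord _ _, x.2⟩

lemma isClosed_cylinder {α : Type} [TopologicalSpace α] [DiscreteTopology α] (w : List α) :
    IsClosed (cylinder w) := by
  simp only [cylinder, ofPred_forall]
  exact isClosed_iInter fun i => isClosed_eq (continuous_apply _) continuous_const

lemma birkhoff_add {Y : Type*} (σ : Y → Y) (f : Y → ℝ) (a b : ℕ) (y : Y) :
    birkhoff σ f (a + b) y = birkhoff σ f a y + birkhoff σ f b (σ^[a] y) := by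
  simp only [birkhoff, Finset.sum_range_add]
  congr 1
  refine Finset.sum_congr rfl fun i _ => ?_
  rw [← Function.iterate_add_apply, add_comm]

lemma abs_birkhoff_le {Y : Type*} (σ : Y → Y) {f : Y → ℝ} {B : ℝ} (hB : ∀ y, |f y| ≤ B) (n : ℕ)
    (y : Y) : |birkhoff σ f n y| ≤ B * n := by
  unfold birkhoff
  refine (Finset.abs_sum_le_sum_abs _ _).trans ?_
  refine (Finset.sum_le_sum fun i _ => hB _).trans ?_
  simp [mul_comm]

/-- A continuous function on a subshift is uniformly continuous in terms of cylinders. -/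
lemma exists_window {α : Type} [Finite α] [TopologicalSpace α] [DiscreteTopology α]
    {X : Set (ℕ → α)} (hX : IsClosed X) {f : X → ℝ} (hf : Continuous f) {ε : ℝ} (hε : 0 < ε) :
    ∃ K : ℕ, ∀ x y : X, (∀ i < K, x.val i = y.val i) → |f x - f y| ≤ ε := by
  let _ : MetricSpace (ℕ → α) := PiNat.metricSpace
  have : CompactSpace X := isCompact_iff_compactSpace.mp hX.isCompact
  obtain ⟨d, hd, h⟩ := Metric.uniformContinuous_iff.mp
    (CompactSpace.uniformContinuous_of_continuous hf) ε hε
  obtain ⟨K, hK⟩ := exists_pow_lt_of_lt_one hd (by norm_num : (1 / 2 : ℝ) < 1)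
  refine ⟨K, fun x y hxy => ?_⟩
  have h1 : x.val ∈ PiNat.cylinder y.val K := PiNat.mem_cylinder_iff.mpr hxy
  have h2 := PiNat.mem_cylinder_iff_dist_le.mp h1
  exact (h (show dist x y < d from h2.trans_lt hK)).le

lemma exists_abs_le {α : Type} [Finite α] [TopologicalSpace α] [DiscreteTopology α]
    {X : Set (ℕ → α)} (hX : IsClosed X) {f : X → ℝ} (hf : Continuous f) :
    ∃ B : ℝ, 0 ≤ B ∧ ∀ x, |f x| ≤ B := by
  have : CompactSpace X := isCompact_iff_compactSpace.mp hX.isCompact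
  obtain ⟨B, hB⟩ := isCompact_univ.exists_bound_of_continuousOn hf.continuousOn
  exact ⟨max B 0, le_max_right _ _, fun x => (hB x (mem_univ x)).trans (le_max_left _ _)⟩

/-! ### Edit distance -/

section EditDistance

open scoped List

/-- `v` is transformed into `w` by a chain of `n` edits. -/
def EditChain {α : Type} (n : ℕ) (v w : List α) : Prop :=
  ∃ f : ℕ → List α, f 0 = v ∧ f n = w ∧ ∀ i < n, EditStep (f i) (f (i + 1))

lemma EditChain.tail {α : Type} {n : ℕ} {v w w' : List α} (h : EditChain n v w)
    (hs : EditStep w w') : EditChain (n + 1) v w' := by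
  obtain ⟨f, h0, hn, hf⟩ := h
  refine ⟨fun i => if i ≤ n then f i else w', by simp [h0], by simp, fun i hi => ?_⟩
  rcases Nat.lt_succ_iff_lt_or_eq.mp hi with h | rfl
  · simpa [h.le, Nat.succ_le_of_lt h] using hf i h
  · simpa [hn] using hs

lemma exists_editChain {α : Type} (v w : List α) : ∃ n, EditChain n v w := by
  have hdel : ∃ n, EditChain n v ([] : List α) := by
    suffices h : ∀ u : List α, (∃ n, EditChain n v u) → ∃ n, EditChain n v ([] : List α) from
      h v ⟨0, fun _ => v, rfl, rfl, by simp⟩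
    intro u
    induction u with
    | nil => exact id
    | cons a u ih =>
      rintro ⟨n, hn⟩
      exact ih ⟨n + 1, hn.tail (Or.inr (Or.inr ⟨[], u, a, by simp, by simp⟩))⟩
  induction w with
  | nil => exact hdel
  | cons a w ih =>
    obtain ⟨n, hn⟩ := ih
    exact ⟨n + 1, hn.tail (Or.inr (Or.inl ⟨[], w, a, by simp, by simp⟩))⟩

/-- Induction along a minimal chain of edits. -/
lemma editDist_induction {α : Type} {v : List α} {Q : ℕ → List α → Prop} (h0 : Q 0 v)
    (hs : ∀ n w w', Q n w → EditStep w w' → Q (n + 1) w') (w : List α) : Q (editDist v w) w := by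
  obtain ⟨f, hf0, hfn, hf⟩ : EditChain (editDist v w) v w :=
    Nat.sInf_mem (s := {n | EditChain n v w}) (exists_editChain v w)
  have h : ∀ i ≤ editDist v w, Q i (f i) := by
    intro i
    induction i with
    | zero => intro _; rwa [hf0]
    | succ i ih => exact fun hi => hs i _ _ (ih (by omega)) (hf i (by omega))
  simpa [hfn] using h _ le_rfl

lemma exists_common_sublist {α : Type} (v w : List α) :
    ∃ z : List α, z <+ v ∧ z <+ w ∧ v.length ≤ z.length + editDist v w ∧
      w.length ≤ z.length + editDist v w := by
  refine editDist_induction (Q := fun n w => ∃ z : List α, z <+ v ∧ z <+ w ∧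
    v.length ≤ z.length + n ∧ w.length ≤ z.length + n) ⟨v, by simp⟩ ?_ w
  have key : ∀ (z u₁ u₂ : List α) (a : α), z <+ u₁ ++ [a] ++ u₂ →
      ∃ z', z' <+ z ∧ z' <+ u₁ ++ u₂ ∧ z.length ≤ z'.length + 1 := by
    intro z u₁ u₂ a h
    rw [List.append_assoc, List.sublist_append_iff] at h
    obtain ⟨z1, z2, rfl, h1, h2⟩ := h
    rw [List.singleton_append, List.sublist_cons_iff] at h2
    rcases h2 with h2 | ⟨z3, rfl, h3⟩
    · exact ⟨z1 ++ z2, List.Sublist.refl _, h1.append h2, by omega⟩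
    · exact ⟨z1 ++ z3, (List.Sublist.refl _).append (List.sublist_cons_self _ _), h1.append h3,
        by simp; omega⟩
  have ins : ∀ (u₁ u₂ : List α) (a : α), u₁ ++ u₂ <+ u₁ ++ [a] ++ u₂ := by
    intro u₁ u₂ a
    rw [List.append_assoc]
    exact (List.Sublist.refl _).append (by simp)
  rintro n w w' ⟨z, hzv, hzw, hv, hw⟩
    (⟨u₁, u₂, a, a', rfl, rfl⟩ | ⟨u₁, u₂, a', rfl, rfl⟩ | ⟨u₁, u₂, a, rfl, rfl⟩)
  · obtain ⟨z', h1, h2, h3⟩ := key z u₁ u₂ a hzw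
    refine ⟨z', h1.trans hzv, h2.trans (ins _ _ _), by omega, ?_⟩
    simp at hw ⊢; omega
  · refine ⟨z, hzv, hzw.trans (ins _ _ _), by omega, ?_⟩
    simp at hw ⊢; omega
  · obtain ⟨z', h1, h2, h3⟩ := key z u₁ u₂ a hzw
    refine ⟨z', h1.trans hzv, h2, by omega, ?_⟩
    simp at hw ⊢; omega

lemma length_le_add_editDist {α : Type} (v w : List α) :
    v.length ≤ w.length + editDist v w ∧ w.length ≤ v.length + editDist v w := by
  obtain ⟨z, h1, h2, h3, h4⟩ := exists_common_sublist v w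
  have := h1.length_le
  have := h2.length_le
  omega

/-- Words of length `n` that can be aligned with `v` at a total cost of `R` insertions and
deletions. -/
def alignBall {α : Type} (v : List α) (n R : ℕ) : Set (List α) :=
  {w | w.length = n ∧ ∃ z : List α, z <+ v ∧ z <+ w ∧ v.length + w.length ≤ 2 * z.length + R}

lemma finite_alignBall {α : Type} [Finite α] (v : List α) (n R : ℕ) : (alignBall v n R).Finite :=
  (List.finite_length_eq α n).subset fun _ h => h.1

lemma mem_alignBall {α : Type} {v w : List α} {r : ℕ} (h : editDist v w ≤ r) :
    w ∈ alignBall v w.length (2 * r) := by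
  obtain ⟨z, h1, h2, h3, h4⟩ := exists_common_sublist v w
  exact ⟨rfl, z, h1, h2, by omega⟩

/-- Words obtained by prepending a letter to a word of `alignBall v n (R - 1)`. -/
def alignInsert {α : Type} (v : List α) (n R : ℕ) : Set (List α) :=
  {w | 0 < R ∧ ∃ b, ∃ w' ∈ alignBall v n (R - 1), w = b :: w'}

lemma ncard_alignInsert_le {α : Type} [Finite α] (v : List α) (n R : ℕ) :
    (alignInsert v n (R + 1)).ncard ≤ Nat.card α * (alignBall v n R).ncard := by
  have h : alignInsert v n (R + 1) ⊆
      (fun p : α × List α => p.1 :: p.2) '' (univ ×ˢ alignBall v n R) := by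
    rintro w ⟨-, b, w', hw', rfl⟩
    exact ⟨(b, w'), ⟨mem_univ _, hw'⟩, rfl⟩
  have hf : ((univ : Set α) ×ˢ alignBall v n R).Finite := finite_univ.prod (finite_alignBall v n R)
  calc _ ≤ _ := Set.ncard_le_ncard h (hf.image _)
    _ ≤ _ := Set.ncard_image_le hf
    _ = _ := by rw [Set.ncard_prod, Set.ncard_univ]

lemma alignInsert_zero {α : Type} (v : List α) (n : ℕ) : alignInsert v n 0 = ∅ := by
  simp [alignInsert]

lemma alignBall_nil_subset {α : Type} (n R : ℕ) :
    alignBall ([] : List α) (n + 1) R ⊆ alignInsert [] n R := by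
  rintro w ⟨hw, z, hzv, hzw, hR⟩
  obtain rfl := List.sublist_nil.mp hzv
  obtain ⟨b, w', rfl⟩ := List.exists_cons_of_length_eq_add_one hw
  simp at hw hR
  exact ⟨by omega, b, w', ⟨hw, [], by simp, by simp, by simp; omega⟩, rfl⟩

lemma alignBall_cons_subset {α : Type} (a : α) (v : List α) (n R : ℕ) :
    alignBall (a :: v) (n + 1) R ⊆ List.cons a '' alignBall v n R ∪
      {w | 0 < R ∧ w ∈ alignBall v (n + 1) (R - 1)} ∪ alignInsert (a :: v) n R := by
  rintro w ⟨hw, z, hzv, hzw, hR⟩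
  obtain ⟨b, w', rfl⟩ := List.exists_cons_of_length_eq_add_one hw
  simp at hw hR
  have hl := hzv.length_le
  simp at hl
  rcases List.sublist_cons_iff.mp hzw with h1 | ⟨z1, rfl, h1⟩
  · have := h1.length_le
    exact Or.inr ⟨by omega, b, w', ⟨hw, z, hzv, h1, by simp; omega⟩, rfl⟩
  · rcases List.sublist_cons_iff.mp hzv with h2 | ⟨z2, h2, h3⟩
    · have := h2.length_le
      have := h1.length_le
      simp at *
      exact Or.inl (Or.inr ⟨by omega, by simpa using hw, b :: z1, h2, by simpa using h1,
        by simp; omega⟩)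
    · obtain ⟨rfl, rfl⟩ := List.cons_eq_cons.mp h2
      simp at hR
      exact Or.inl (Or.inl ⟨w', ⟨hw, z1, h3, h1, by omega⟩, rfl⟩)

/-- The number of words close to a given word in edit distance grows subexponentially: the
cost `R` is counted with a constant base, the lengths with an arbitrarily small exponent. -/
lemma ncard_alignBall_le {α : Type} [Finite α] {ε Λ : ℝ} (hΛ : 1 ≤ Λ)
    (h : Real.exp (-(2 * ε)) + Λ⁻¹ * (1 + Nat.card α) * Real.exp (-ε) ≤ 1) (hε : 0 ≤ ε)
    (v : List α) (n R : ℕ) :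
    ((alignBall v n R).ncard : ℝ) ≤ Λ ^ R * Real.exp (ε * (v.length + n)) := by
  have hΛ0 : 0 < Λ := by linarith
  have hins : ∀ (v : List α) (n R : ℕ),
      (∀ R, ((alignBall v n R).ncard : ℝ) ≤ Λ ^ R * Real.exp (ε * (v.length + n))) →
      ((alignInsert v n R).ncard : ℝ) ≤
        Nat.card α * Λ⁻¹ * Real.exp (-ε) *
          (Λ ^ R * Real.exp (ε * (v.length + (n + 1 : ℕ)))) := by
    intro v n R hv
    rcases R with _ | R
    · rw [alignInsert_zero]
      simp only [ncard_empty, Nat.cast_zero]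
      positivity
    · have h1 : ((alignInsert v n (R + 1)).ncard : ℝ) ≤ Nat.card α * (alignBall v n R).ncard := by
        exact_mod_cast ncard_alignInsert_le v n R
      refine h1.trans ((mul_le_mul_of_nonneg_left (hv R) (by positivity)).trans (le_of_eq ?_))
      have h2 : Real.exp (ε * (v.length + n)) =
          Real.exp (-ε) * Real.exp (ε * (v.length + (n + 1 : ℕ))) := by
        rw [← Real.exp_add]; congr 1; push_cast; ring
      rw [h2, pow_succ]
      field_simp
  have hzero : ∀ (v : List α) (R : ℕ),
      ((alignBall v 0 R).ncard : ℝ) ≤ Λ ^ R * Real.exp (ε * (v.length + (0 : ℕ))) := by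
    intro v R
    have h1 : alignBall v 0 R ⊆ {[]} := fun w hw => List.length_eq_zero_iff.mp hw.1
    have h2 : ((alignBall v 0 R).ncard : ℝ) ≤ 1 := by
      have := Set.ncard_le_ncard h1
      rw [Set.ncard_singleton] at this
      exact_mod_cast this
    have h3 : 1 ≤ Λ ^ R := one_le_pow₀ hΛ
    have h4 : 1 ≤ Real.exp (ε * (v.length + (0 : ℕ))) := Real.one_le_exp (by positivity)
    nlinarith
  have hle : Nat.card α * Λ⁻¹ * Real.exp (-ε) ≤ 1 := by
    have h1 : 0 ≤ Real.exp (-(2 * ε)) := (Real.exp_pos _).le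
    have h2 : 0 ≤ Λ⁻¹ * Real.exp (-ε) := by positivity
    nlinarith
  induction v generalizing n R with
  | nil =>
    induction n generalizing R with
    | zero => exact hzero [] R
    | succ n ih =>
      have h1 : ((alignBall ([] : List α) (n + 1) R).ncard : ℝ) ≤ (alignInsert ([] : List α) n R).ncard := by
        have hfin : (alignInsert ([] : List α) n R).Finite :=
          (List.finite_length_eq α (n + 1)).subset (by
            rintro w ⟨-, b, w', hw', rfl⟩; simpa using hw'.1)
        exact_mod_cast Set.ncard_le_ncard (alignBall_nil_subset n R) hfin
      refine h1.trans ((hins [] n R ih).trans ?_)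
      exact mul_le_of_le_one_left (by positivity) hle
  | cons a v ihv =>
    induction n generalizing R with
    | zero => exact hzero (a :: v) R
    | succ n ih =>
      set E : ℝ := Λ ^ R * Real.exp (ε * ((a :: v).length + (n + 1 : ℕ))) with hE
      have hfin : (alignInsert (a :: v) n R).Finite :=
        (List.finite_length_eq α (n + 1)).subset (by
          rintro w ⟨-, b, w', hw', rfl⟩; simpa using hw'.1)
      have hfin1 : (List.cons a '' alignBall v n R).Finite := (finite_alignBall v n R).image _
      have hfin2 : {w | 0 < R ∧ w ∈ alignBall v (n + 1) (R - 1)}.Finite :=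
        (finite_alignBall v (n + 1) (R - 1)).subset fun w hw => hw.2
      have h1 : ((alignBall (a :: v) (n + 1) R).ncard : ℝ) ≤
          (alignBall v n R).ncard + {w | 0 < R ∧ w ∈ alignBall v (n + 1) (R - 1)}.ncard +
            (alignInsert (a :: v) n R).ncard := by
        have h2 := Set.ncard_le_ncard (alignBall_cons_subset a v n R)
          ((hfin1.union hfin2).union hfin)
        have h3 := Set.ncard_union_le (List.cons a '' alignBall v n R ∪
          {w | 0 < R ∧ w ∈ alignBall v (n + 1) (R - 1)}) (alignInsert (a :: v) n R)
        have h4 := Set.ncard_union_le (List.cons a '' alignBall v n R)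
          {w | 0 < R ∧ w ∈ alignBall v (n + 1) (R - 1)}
        have h5 := Set.ncard_image_le (f := List.cons a) (finite_alignBall v n R)
        exact_mod_cast (by omega : (alignBall (a :: v) (n + 1) R).ncard ≤
          (alignBall v n R).ncard + {w | 0 < R ∧ w ∈ alignBall v (n + 1) (R - 1)}.ncard +
            (alignInsert (a :: v) n R).ncard)
      have hA : ((alignBall v n R).ncard : ℝ) ≤ Real.exp (-(2 * ε)) * E := by
        refine (ihv n R).trans (le_of_eq ?_)
        have : Real.exp (ε * (v.length + n)) = Real.exp (-(2 * ε)) *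
            Real.exp (ε * ((a :: v).length + (n + 1 : ℕ))) := by
          rw [← Real.exp_add]; congr 1; push_cast [List.length_cons]; ring
        rw [this, hE]; ring
      have hB : ({w | 0 < R ∧ w ∈ alignBall v (n + 1) (R - 1)}.ncard : ℝ) ≤
          Λ⁻¹ * Real.exp (-ε) * E := by
        rcases R with _ | R
        · simp only [lt_irrefl, false_and]
          have : 0 ≤ Λ⁻¹ * Real.exp (-ε) * E := by positivity
          simpa using this
        · have := ihv (n + 1) R
          simp only [Nat.succ_pos, true_and, Nat.add_sub_cancel, Set.ofPred_mem_eq]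
          refine this.trans (le_of_eq ?_)
          have h2 : Real.exp (ε * (v.length + (n + 1 : ℕ))) = Real.exp (-ε) *
              Real.exp (ε * ((a :: v).length + (n + 1 : ℕ))) := by
            rw [← Real.exp_add]; congr 1; push_cast [List.length_cons]; ring
          rw [h2, hE, pow_succ]
          field_simp
      have hC := hins (a :: v) n R ih
      rw [← hE] at hC
      have hE0 : 0 ≤ E := by positivity
      have := mul_le_mul_of_nonneg_right h hE0
      linarith

lemma exists_alignBall_base (α : Type) [Finite α] {ε : ℝ} (hε : 0 < ε) :
    ∃ Λ : ℝ, 1 ≤ Λ ∧ ∀ (v : List α) (n R : ℕ),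
      ((alignBall v n R).ncard : ℝ) ≤ Λ ^ R * Real.exp (ε * (v.length + n)) := by
  have h0 : 0 < 1 - Real.exp (-ε) := by
    have : Real.exp (-ε) < 1 := by
      rw [← Real.exp_zero]; exact Real.exp_lt_exp.mpr (by linarith)
    linarith
  have h1 : 1 - Real.exp (-ε) ≤ 1 := by linarith [Real.exp_pos (-ε)]
  have hc : (0 : ℝ) ≤ Nat.card α := by positivity
  refine ⟨(1 + Nat.card α) / (1 - Real.exp (-ε)), ?_, ncard_alignBall_le ?_ ?_ hε.le⟩
  · rw [le_div_iff₀ h0]; linarith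
  · rw [le_div_iff₀ h0]; linarith
  · have h2 : Real.exp (-(2 * ε)) = Real.exp (-ε) * Real.exp (-ε) := by
      rw [← Real.exp_add]; congr 1; ring
    have h3 : ((1 + (Nat.card α : ℝ)) / (1 - Real.exp (-ε)))⁻¹ * (1 + Nat.card α) =
        1 - Real.exp (-ε) := by
      field_simp
    rw [h2, h3]
    have : Real.exp (-ε) ≤ 1 := by linarith
    nlinarith

end EditDistance

/-! ### Approximating Birkhoff sums by functions of words -/

/-- The sum of `h` over all windows of length `K` in a word (shorter ones at the end). -/
def windowSum {α : Type} (K : ℕ) (h : List α → ℝ) : List α → ℝ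
  | [] => 0
  | a :: w => h ((a :: w).take K) + windowSum K h w

lemma abs_windowSum_append_sub {α : Type} {K : ℕ} {h : List α → ℝ} {B : ℝ} (hB : ∀ u, |h u| ≤ B)
    (u y y' : List α) :
    |windowSum K h (u ++ y) - windowSum K h (u ++ y')| ≤
      2 * B * K + |windowSum K h y - windowSum K h y'| := by
  have hB0 : 0 ≤ B := (abs_nonneg _).trans (hB [])
  suffices H : |windowSum K h (u ++ y) - windowSum K h (u ++ y')| ≤
      2 * B * (min u.length K : ℕ) + |windowSum K h y - windowSum K h y'| by
    refine H.trans ?_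
    have : ((min u.length K : ℕ) : ℝ) ≤ K := by exact_mod_cast min_le_right _ _
    gcongr
  induction u with
  | nil => simp
  | cons a u ih =>
    simp only [List.cons_append, windowSum]
    by_cases hK : K ≤ (a :: u).length
    · have h1 : ∀ y : List α, (a :: (u ++ y)).take K = (a :: u).take K := fun y => by
        rw [← List.cons_append, List.take_append_of_le_length hK]
      rw [h1, h1, add_sub_add_left_eq_sub]
      refine ih.trans ?_
      have : ((min u.length K : ℕ) : ℝ) ≤ (min (a :: u).length K : ℕ) := by
        exact_mod_cast min_le_min_right _ (by simp)
      gcongr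
    · have h1 : min (a :: u).length K = min u.length K + 1 := by simp at hK ⊢; omega
      rw [h1]
      have h2 := abs_le.mp (hB ((a :: (u ++ y)).take K))
      have h3 := abs_le.mp (hB ((a :: (u ++ y')).take K))
      have h4 := abs_le.mp ih
      push_cast at h4 ⊢
      rw [abs_le]
      constructor <;> linarith

lemma abs_windowSum_sub_of_editStep {α : Type} {K : ℕ} {h : List α → ℝ} {B : ℝ}
    (hB : ∀ u, |h u| ≤ B) {w w' : List α} (hs : EditStep w w') :
    |windowSum K h w - windowSum K h w'| ≤ 4 * B * K + 2 * B := by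
  have hB0 : 0 ≤ B := (abs_nonneg _).trans (hB [])
  have key : ∀ (u₁ u₂ : List α) (a : α),
      |windowSum K h (u₁ ++ [a] ++ u₂) - windowSum K h (u₁ ++ u₂)| ≤ 2 * B * K + B := by
    intro u₁ u₂ a
    rw [List.append_assoc]
    refine (abs_windowSum_append_sub hB _ _ _).trans ?_
    simpa [windowSum] using hB _
  have hBK : 0 ≤ B * K := by positivity
  rcases hs with ⟨u₁, u₂, a, a', rfl, rfl⟩ | ⟨u₁, u₂, a', rfl, rfl⟩ | ⟨u₁, u₂, a, rfl, rfl⟩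
  · have h1 := abs_le.mp (key u₁ u₂ a)
    have h2 := abs_le.mp (key u₁ u₂ a')
    rw [abs_le]
    constructor <;> linarith
  · rw [abs_sub_comm]
    exact (key u₁ u₂ a').trans (by linarith)
  · exact (key u₁ u₂ a).trans (by linarith)

/-- `F` approximates the Birkhoff sums of `f` on cylinders up to a relative error `ε` and an
additive error `C`, and is `C`-Lipschitz for the edit distance. -/
structure WordApprox {α : Type} (X : Set (ℕ → α)) (f : X → ℝ) (ε C : ℝ) (F : List α → ℝ) :
    Prop where
  approx : ∀ (w : List α) (x : X), x.val ∈ cylinder w →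
    |birkhoff (subShift X) f w.length x - F w| ≤ ε * w.length + C
  lipschitz : ∀ v w, |F v - F w| ≤ C * editDist v w

lemma WordApprox.mono {α : Type} {X : Set (ℕ → α)} {f : X → ℝ} {ε C C' : ℝ} {F : List α → ℝ}
    (h : WordApprox X f ε C F) (hC : C ≤ C') : WordApprox X f ε C' F where
  approx w x hx := (h.approx w x hx).trans (by linarith)
  lipschitz v w := (h.lipschitz v w).trans (by gcongr)

lemma WordApprox.abs_le {α : Type} {X : Set (ℕ → α)} {f : X → ℝ} {ε C B : ℝ} {F : List α → ℝ}
    (h : WordApprox X f ε C F) (hB : ∀ x, |f x| ≤ B) {w : List α} (hw : w ∈ language X) :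
    |F w| ≤ (B + ε) * w.length + C := by
  obtain ⟨x, hx, hX⟩ := hw
  have h1 := _root_.abs_le.mp (h.approx w ⟨x, hX⟩ hx)
  have h2 := _root_.abs_le.mp (abs_birkhoff_le (subShift X) hB w.length ⟨x, hX⟩)
  rw [_root_.abs_le]
  constructor <;> linarith

lemma exists_wordApprox {α : Type} [Finite α] [TopologicalSpace α] [DiscreteTopology α]
    {X : Set (ℕ → α)} (hX : IsClosed X) (hXinv : MapsTo shift X X) {f : X → ℝ}
    (hf : Continuous f) {ε : ℝ} (hε : 0 < ε) : ∃ C F, 0 ≤ C ∧ WordApprox X f ε C F := by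
  obtain ⟨K, hK⟩ := exists_window hX hf hε
  obtain ⟨B, hB0, hB⟩ := exists_abs_le hX hf
  let h : List α → ℝ := fun u =>
    if hu : ∃ x : X, x.val ∈ cylinder u then f hu.choose else 0
  have hh : ∀ u, |h u| ≤ B := by
    intro u
    simp only [h]
    split_ifs
    · exact hB _
    · simpa using hB0
  have hBK : 0 ≤ B * K := by positivity
  refine ⟨4 * B * K + 2 * B, windowSum K h, by linarith, ?_, ?_⟩
  · intro w x hx
    have hstep : ∀ (u : List α) (x : X), x.val ∈ cylinder u →
        |f x - h (u.take K)| ≤ if K ≤ u.length then ε else 2 * B := by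
      intro u x hx
      have hx' : x.val ∈ cylinder (u.take K) := by
        rw [mem_cylinder_iff] at hx ⊢
        intro i hi
        rw [hx i (by simp at hi; omega), List.getElem_take]
      have hex : ∃ x : X, x.val ∈ cylinder (u.take K) := ⟨x, hx'⟩
      split_ifs with hl
      · simp only [h, dif_pos hex]
        refine hK _ _ fun i hi => ?_
        have hi' : i < (u.take K).length := by simp; omega
        rw [mem_cylinder_iff.mp hx' i hi', mem_cylinder_iff.mp hex.choose_spec i hi']
      · have h1 := _root_.abs_le.mp (hB x)
        have h2 := _root_.abs_le.mp (hh (u.take K))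
        rw [_root_.abs_le]
        constructor <;> linarith
    suffices H : |birkhoff (subShift X) f w.length x - windowSum K h w| ≤
        ε * w.length + 2 * B * (min w.length K : ℕ) by
      refine H.trans ?_
      have : ((min w.length K : ℕ) : ℝ) ≤ K := by exact_mod_cast min_le_right _ _
      have : 2 * B * (min w.length K : ℕ) ≤ 2 * B * K := by gcongr
      linarith
    induction w generalizing x with
    | nil => simp [birkhoff, windowSum]
    | cons a w ih =>
      have hx2 : (subShift X x).val ∈ cylinder w := by
        have := subShift_iterate_val hXinv 1 x
        simp only [Function.iterate_one] at this
        rw [this]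
        exact (mem_cylinder_cons.mp hx).2
      have h1 := _root_.abs_le.mp (ih _ hx2)
      have h2 := hstep _ x hx
      have h3 : birkhoff (subShift X) f (a :: w).length x =
          f x + birkhoff (subShift X) f w.length (subShift X x) := by
        rw [List.length_cons, add_comm, birkhoff_add]
        simp [birkhoff]
      rw [h3, windowSum]
      split_ifs at h2 with hl
      · have h2 := _root_.abs_le.mp h2
        have : ((min w.length K : ℕ) : ℝ) ≤ (min (a :: w).length K : ℕ) := by
          exact_mod_cast min_le_min_right _ (by simp)
        have : 2 * B * (min w.length K : ℕ) ≤ 2 * B * (min (a :: w).length K : ℕ) := by gcongr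
        push_cast [List.length_cons] at *
        rw [_root_.abs_le]
        constructor <;> linarith
      · have h2 := _root_.abs_le.mp h2
        have h4 : min (a :: w).length K = min w.length K + 1 := by simp at hl ⊢; omega
        rw [h4]
        push_cast [List.length_cons] at *
        rw [_root_.abs_le]
        constructor <;> linarith
  · intro v w
    refine editDist_induction (Q := fun n w =>
      |windowSum K h v - windowSum K h w| ≤ (4 * B * K + 2 * B) * n) (by simp) ?_ w
    intro n w w' hw hs
    have h1 := _root_.abs_le.mp (abs_windowSum_sub_of_editStep (K := K) hh hs)
    have h2 := _root_.abs_le.mp hw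
    push_cast
    rw [_root_.abs_le]
    constructor <;> linarith

/-! ### Long words in the approximating collection -/

lemma MistakeFun.eventually_le {g : ℕ → ℕ} (hg : MistakeFun g) {κ : ℝ} (hκ : 0 < κ) :
    ∀ᶠ n in atTop, (g n : ℝ) ≤ κ * n := by
  filter_upwards [hg.2.eventually (gt_mem_nhds hκ), eventually_gt_atTop 0] with n hn h0
  have : (0 : ℝ) < n := by exact_mod_cast h0
  exact ((div_lt_iff₀ this).mp hn).le

lemma birkhoff_neg {Y : Type*} (σ : Y → Y) (f : Y → ℝ) (n : ℕ) (y : Y) :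
    birkhoff σ (-f) n y = -birkhoff σ f n y := by
  simp [birkhoff]

lemma WordApprox.neg {α : Type} {X : Set (ℕ → α)} {f : X → ℝ} {ε C : ℝ} {F : List α → ℝ}
    (h : WordApprox X f ε C F) : WordApprox X (-f) ε C (-F) where
  approx w x hx := by
    have := h.approx w x hx
    rw [abs_sub_comm] at this
    rw [birkhoff_neg, Pi.neg_apply, neg_sub_neg]
    exact this
  lipschitz v w := by
    have := h.lipschitz v w
    rw [abs_sub_comm] at this
    rw [Pi.neg_apply, Pi.neg_apply, neg_sub_neg]
    exact this

lemma exists_good_word_lt {α : Type} {X : Set (ℕ → α)} {G : Set (List α)} {g : ℕ → ℕ}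
    (hg : MistakeFun g) (happ : ∀ w ∈ language X, ∃ v ∈ G, editDist v w ≤ g w.length)
    {f : X → ℝ} {ε C : ℝ} {F : List α → ℝ} (hF : WordApprox X f ε C F) (hC : 0 ≤ C)
    {a δ : ℝ} (hεδ : ε < δ) (hδ : 0 ≤ δ) {x : X}
    (hx : ∃ᶠ n in atTop, birkAvg (subShift X) f n x < a) (M : ℕ) :
    ∃ v ∈ G, M ≤ v.length ∧ F v ≤ (a + δ) * v.length := by
  set κ : ℝ := (δ - ε) / (2 * (C + |a| + δ + 1)) with hκ
  have hden : 0 < C + |a| + δ + 1 := by positivity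
  have hκ0 : 0 < κ := div_pos (by linarith) (by positivity)
  have hbig : ∀ᶠ n : ℕ in atTop, C ≤ (δ - ε) / 2 * n :=
    (tendsto_natCast_atTop_atTop.const_mul_atTop (by linarith)).eventually_ge_atTop C
  obtain ⟨n, hn, h1, h2, h3, h4⟩ := (hx.and_eventually ((hg.eventually_le hκ0).and
    ((hg.eventually_le (by norm_num : (0 : ℝ) < 1 / 2)).and
      (hbig.and (eventually_ge_atTop (2 * M + 1)))))).exists
  have hn0 : (0 : ℝ) < n := by exact_mod_cast (by omega : 0 < n)
  obtain ⟨v, hv, hd⟩ := happ _ (prefixWord_mem_language x n)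
  rw [length_prefixWord] at hd
  have hlen := length_le_add_editDist v (prefixWord x.val n)
  rw [length_prefixWord] at hlen
  set w := prefixWord x.val n with hw
  have hS : birkhoff (subShift X) f n x < a * n := by
    unfold birkAvg at hn
    rwa [inv_mul_lt_iff₀ hn0, mul_comm] at hn
  have hA := abs_le.mp (hF.approx w x (mem_cylinder_prefixWord _ _))
  rw [hw, length_prefixWord, ← hw] at hA
  have hL := abs_le.mp (hF.lipschitz v w)
  have hd' : (editDist v w : ℝ) ≤ g n := by exact_mod_cast hd
  have hCd : C * editDist v w ≤ C * g n := by gcongr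
  have hl1 : (v.length : ℝ) ≤ n + g n := by exact_mod_cast (by omega : v.length ≤ n + g n)
  have hl2 : (n : ℝ) ≤ v.length + g n := by exact_mod_cast (by omega : n ≤ v.length + g n)
  refine ⟨v, hv, ?_, ?_⟩
  · have h5 : (2 * M + 1 : ℝ) ≤ n := by exact_mod_cast h4
    have : (M : ℝ) ≤ v.length := by linarith
    exact_mod_cast this
  · have h6 : (C + |a| + δ + 1) * g n ≤ (δ - ε) / 2 * n := by
      calc _ ≤ (C + |a| + δ + 1) * (κ * n) := by gcongr
        _ = _ := by rw [hκ]; field_simp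
    have h7 : -((|a| + δ) * g n) ≤ (a + δ) * (v.length - n) := by
      have h8 : |(a + δ) * (v.length - n)| ≤ (|a| + δ) * g n := by
        rw [abs_mul]
        have : |a + δ| ≤ |a| + δ := (abs_add_le _ _).trans (by rw [abs_of_nonneg hδ])
        have : |(v.length : ℝ) - n| ≤ g n := abs_le.mpr ⟨by linarith, by linarith⟩
        gcongr
      exact (abs_le.mp h8).1
    have h9 : (0 : ℝ) ≤ g n := by positivity
    linarith

/-- The words of length `n` in the language of `X`. -/
noncomputable def words {α : Type} [Finite α] (X : Set (ℕ → α)) (n : ℕ) : Finset (List α) :=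
  ((List.finite_length_eq α n).inter_of_right (language X)).toFinset

lemma mem_words {α : Type} [Finite α] {X : Set (ℕ → α)} {n : ℕ} {w : List α} :
    w ∈ words X n ↔ w ∈ language X ∧ w.length = n := by
  simp [words]

lemma eventually_linear_le_exp {K b : ℝ} (hb : 0 < b) :
    ∀ᶠ n : ℕ in atTop, (2 * n + 1) * K ≤ Real.exp (b * n) := by
  have h1 := (isLittleO_pow_exp_pos_mul_atTop 1 hb).comp_tendsto
    (tendsto_natCast_atTop_atTop (R := ℝ))
  have h2 := h1.bound (c := (3 * (|K| + 1))⁻¹) (by positivity)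
  filter_upwards [h2, eventually_ge_atTop 1] with n hn h1
  have hn1 : (1 : ℝ) ≤ n := by exact_mod_cast h1
  simp only [Function.comp, pow_one, Real.norm_eq_abs, Nat.abs_cast, Real.abs_exp] at hn
  rw [inv_mul_eq_div, le_div_iff₀ (by positivity)] at hn
  have : (2 * n + 1) * K ≤ (2 * n + 1) * (|K| + 1) := by
    have := le_abs_self K
    gcongr
    linarith
  have h4 : 0 ≤ |K| + 1 := by positivity
  nlinarith

set_option maxHeartbeats 1000000 in
/-- Among the words of the approximating collection there are, at arbitrarily large scales `m`,
enough words of length `m` to carry the exponential growth rate `t`, all having nearly the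
same average with respect to a second potential. -/
lemma exists_good_blocks {α : Type} [Finite α] {X : Set (ℕ → α)} {G : Set (List α)} {g : ℕ → ℕ}
    (hG : G ⊆ language X) (hg : MistakeFun g)
    (happ : ∀ w ∈ language X, ∃ v ∈ G, editDist v w ≤ g w.length)
    {F H : List α → ℝ} {B C : ℝ} (hC : 0 ≤ C)
    (hF : ∀ v w, |F v - F w| ≤ C * editDist v w)
    (hH : ∀ v ∈ language X, |H v| ≤ B * v.length + C) {t c : ℝ} (hc : 0 < c)
    (hsum : ∀ᶠ n : ℕ in atTop, c * Real.exp (t * n) ≤ ∑ w ∈ words X n, Real.exp (F w))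
    {δ : ℝ} (hδ : 0 < δ) (M : ℕ) :
    ∃ (m : ℕ) (γ : ℝ) (D : Finset (List α)), M ≤ m ∧ |γ| ≤ B + C + 2 * δ ∧
      (∀ d ∈ D, d ∈ G ∧ d.length = m ∧ |H d - γ * m| ≤ δ * m) ∧
      Real.exp ((t - δ) * m) ≤ ∑ d ∈ D, Real.exp (F d) := by
  obtain ⟨Λ, hΛ, hball⟩ := exists_alignBall_base α (ε := δ / 12) (by positivity)
  have hΛ0 : 0 < Λ := by linarith
  have hlog : 0 ≤ Real.log Λ := Real.log_nonneg hΛ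
  set J : ℕ := ⌈(B + C) / δ⌉₊ + 1 with hJ
  have hQ : 0 < |t| + δ + C + 2 * Real.log Λ := by positivity
  set κ : ℝ := min (1 / 2) (δ / 4 / (|t| + δ + C + 2 * Real.log Λ)) with hκ
  have hκ0 : 0 < κ := lt_min (by norm_num) (by positivity)
  obtain ⟨n, hn1, hn2, hn3, hn4⟩ := (hsum.and ((hg.eventually_le hκ0).and
    ((eventually_linear_le_exp (K := (2 * J + 1) / c) (by positivity : 0 < δ / 4)).and
      (eventually_ge_atTop (2 * M + 2))))).exists
  set r := g n with hr
  have hn0 : (2 * M + 2 : ℝ) ≤ n := by exact_mod_cast hn4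
  have hr1 : (r : ℝ) ≤ 1 / 2 * n := hn2.trans (by gcongr; exact min_le_left _ _)
  have hr2 : (|t| + δ + C + 2 * Real.log Λ) * r ≤ δ / 4 * n := by
    have h1 : (r : ℝ) ≤ δ / 4 / (|t| + δ + C + 2 * Real.log Λ) * n :=
      hn2.trans (by gcongr; exact min_le_right _ _)
    calc _ ≤ (|t| + δ + C + 2 * Real.log Λ) *
        (δ / 4 / (|t| + δ + C + 2 * Real.log Λ) * n) := by gcongr
      _ = _ := by field_simp
  choose! v hvG hvd using happ
  have hvd' : ∀ w ∈ words X n, editDist (v w) w ≤ r := fun w hw => by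
    have h := mem_words.mp hw
    have := hvd w h.1
    rwa [h.2] at this
  have hlen : ∀ u ∈ (words X n).image v, (u.length : ℝ) ≤ n + r ∧ (n : ℝ) ≤ u.length + r := by
    intro u hu
    obtain ⟨w, hw, rfl⟩ := Finset.mem_image.mp hu
    have h1 := length_le_add_editDist (v w) w
    have h2 := hvd' w hw
    rw [(mem_words.mp hw).2] at h1
    constructor
    · exact_mod_cast (by omega : (v w).length ≤ n + r)
    · exact_mod_cast (by omega : n ≤ (v w).length + r)
  have hVG : ∀ u ∈ (words X n).image v, u ∈ G := by
    intro u hu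
    obtain ⟨w, hw, rfl⟩ := Finset.mem_image.mp hu
    exact hvG w (mem_words.mp hw).1
  -- the sum over the language is controlled by the sum over the approximating words
  have hstep : ∑ w ∈ words X n, Real.exp (F w) ≤
      Real.exp (C * r + 2 * r * Real.log Λ + δ / 4 * n) *
        ∑ u ∈ (words X n).image v, Real.exp (F u) := by
    calc ∑ w ∈ words X n, Real.exp (F w)
        ≤ ∑ w ∈ words X n, Real.exp (C * r) * Real.exp (F (v w)) := by
          refine Finset.sum_le_sum fun w hw => ?_
          rw [← Real.exp_add]
          refine Real.exp_le_exp.mpr ?_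
          have h1 := (abs_le.mp (hF (v w) w)).1
          have h2 : (editDist (v w) w : ℝ) ≤ r := by exact_mod_cast hvd' w hw
          have h3 : C * editDist (v w) w ≤ C * r := by gcongr
          linarith
      _ = ∑ u ∈ (words X n).image v,
            ((words X n).filter fun w => v w = u).card • (Real.exp (C * r) * Real.exp (F u)) :=
          Finset.sum_comp (fun u => Real.exp (C * r) * Real.exp (F u)) v
      _ ≤ ∑ u ∈ (words X n).image v,
            Real.exp (C * r + 2 * r * Real.log Λ + δ / 4 * n) * Real.exp (F u) := by
          refine Finset.sum_le_sum fun u hu => ?_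
          have hsub : (((words X n).filter fun w => v w = u : Finset (List α)) :
              Set (List α)) ⊆ alignBall u n (2 * r) := by
            intro w hw
            simp only [Finset.coe_filter, mem_ofPred_eq] at hw
            obtain ⟨hw, rfl⟩ := hw
            have := mem_alignBall (hvd' w hw)
            rwa [(mem_words.mp hw).2] at this
          have hcard : (((words X n).filter fun w => v w = u).card : ℝ) ≤
              Real.exp (2 * r * Real.log Λ + δ / 4 * n) := by
            have h1 := Set.ncard_le_ncard hsub (finite_alignBall _ _ _)
            rw [Set.ncard_coe_finset] at h1
            have h2 : (((words X n).filter fun w => v w = u).card : ℝ) ≤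
                (alignBall u n (2 * r)).ncard := by exact_mod_cast h1
            refine h2.trans ((hball u n (2 * r)).trans ?_)
            rw [Real.exp_add]
            have h3 : Λ ^ (2 * r) = Real.exp (2 * r * Real.log Λ) := by
              rw [← Real.exp_log (pow_pos hΛ0 _), Real.log_pow]
              push_cast; rfl
            rw [h3]
            have h4 := (hlen u hu).1
            refine mul_le_mul_of_nonneg_left (Real.exp_le_exp.mpr ?_) (Real.exp_pos _).le
            have h5 : (u.length : ℝ) + n ≤ 3 * n := by linarith
            calc δ / 12 * ((u.length : ℝ) + n) ≤ δ / 12 * (3 * n) := by gcongr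
              _ = _ := by ring
          rw [nsmul_eq_mul, ← mul_assoc]
          gcongr
          rw [add_assoc, Real.exp_add, mul_comm]
          gcongr
      _ = _ := by rw [Finset.mul_sum]
  -- pigeonhole on the length and on the average of `H`
  have hmaps : ∀ u ∈ (words X n).image v, (u.length, ⌊H u / (δ * u.length)⌋) ∈
      Finset.range (2 * n + 1) ×ˢ Finset.Icc (-(J : ℤ)) J := by
    intro u hu
    obtain ⟨h1, h2⟩ := hlen u hu
    have hu1 : (1 : ℝ) ≤ u.length := by
      have : (0 : ℝ) ≤ M := by positivity
      linarith
    have h3 : |H u / (δ * u.length)| ≤ (B + C) / δ := by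
      rw [abs_div, abs_of_pos (by positivity : 0 < δ * u.length), div_le_div_iff₀
        (by positivity) hδ]
      have h4 : |H u| ≤ (B + C) * u.length := by
        have := hH u (hG (hVG u hu))
        nlinarith
      calc |H u| * δ ≤ (B + C) * u.length * δ := by gcongr
        _ = _ := by ring
    have h5 : (B + C) / δ ≤ J - 1 := by
      rw [hJ]; push_cast
      linarith [Nat.le_ceil ((B + C) / δ)]
    obtain ⟨h6, h7⟩ := abs_le.mp h3
    rw [Finset.mem_product, Finset.mem_range, Finset.mem_Icc]
    refine ⟨?_, ?_, ?_⟩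
    · have : (u.length : ℝ) < (2 * n + 1 : ℕ) := by push_cast; linarith
      exact_mod_cast this
    · rw [Int.le_floor]; push_cast; linarith
    · have h8 := Int.floor_le (H u / (δ * u.length))
      have : ((⌊H u / (δ * u.length)⌋ : ℤ) : ℝ) ≤ (J : ℤ) := by push_cast; linarith
      exact_mod_cast this
  set T := Finset.range (2 * n + 1) ×ˢ Finset.Icc (-(J : ℤ)) J with hT
  have hTcard : (T.card : ℝ) = (2 * n + 1) * (2 * J + 1) := by
    rw [hT, Finset.card_product, Finset.card_range, Int.card_Icc]
    have : ((J : ℤ) + 1 - -(J : ℤ)).toNat = 2 * J + 1 := by omega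
    rw [this]; push_cast; ring
  have hTpos : (0 : ℝ) < T.card := by rw [hTcard]; positivity
  obtain ⟨⟨m, j⟩, -, hmj⟩ := Finset.exists_le_sum_fiber_of_maps_to_of_nsmul_le_sum
    (w := fun u => Real.exp (F u))
    (b := (∑ u ∈ (words X n).image v, Real.exp (F u)) / T.card) hmaps
    (Finset.card_pos.mp (by exact_mod_cast hTpos))
    (by rw [nsmul_eq_mul, mul_div_cancel₀ _ hTpos.ne'])
  set D := ((words X n).image v).filter fun u => (u.length, ⌊H u / (δ * u.length)⌋) = (m, j)
    with hD
  have hmain : Real.exp (t * n - (C * r + 2 * r * Real.log Λ + δ / 4 * n) - δ / 4 * n) ≤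
      ∑ d ∈ D, Real.exp (F d) := by
    refine le_trans ?_ hmj
    rw [le_div_iff₀ hTpos, hTcard, Real.exp_sub, Real.exp_sub]
    have h1 := hn1.trans hstep
    rw [mul_div_assoc', div_le_iff₀ hc] at hn3
    have hP := Real.exp_pos (C * r + 2 * r * Real.log Λ + δ / 4 * n)
    have hP2 := Real.exp_pos (δ / 4 * n)
    have hP3 := Real.exp_pos (t * n)
    rw [div_div, div_mul_eq_mul_div, div_le_iff₀ (by positivity)]
    calc Real.exp (t * n) * ((2 * n + 1) * (2 * J + 1))
        ≤ Real.exp (t * n) * (Real.exp (δ / 4 * n) * c) := by gcongr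
      _ = c * Real.exp (t * n) * Real.exp (δ / 4 * n) := by ring
      _ ≤ (Real.exp (C * r + 2 * r * Real.log Λ + δ / 4 * n) *
        ∑ u ∈ (words X n).image v, Real.exp (F u)) * Real.exp (δ / 4 * n) := by gcongr
      _ = _ := by ring
  have hDmem : ∀ d ∈ D, d ∈ (words X n).image v ∧ d.length = m ∧
      ⌊H d / (δ * d.length)⌋ = j := by
    intro d hd
    rw [hD, Finset.mem_filter, Prod.mk.injEq] at hd
    exact ⟨hd.1, hd.2.1, hd.2.2⟩
  obtain ⟨d, hd⟩ : D.Nonempty := by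
    rw [Finset.nonempty_iff_ne_empty]
    intro h
    rw [h, Finset.sum_empty] at hmain
    exact absurd hmain (not_le.mpr (Real.exp_pos _))
  obtain ⟨hd1, hd2, hd3⟩ := hDmem d hd
  obtain ⟨hm1, hm2⟩ := hlen d hd1
  rw [hd2] at hm1 hm2
  have hM0 : (0 : ℝ) ≤ M := by positivity
  have hmM : (M : ℝ) + 1 ≤ m := by linarith
  have hm0 : (0 : ℝ) < m := by linarith
  have hDH : ∀ d ∈ D, |H d - j * δ * m| ≤ δ * m := by
    intro d hd
    obtain ⟨-, h2, h3⟩ := hDmem d hd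
    rw [h2] at h3
    have h4 := Int.floor_le (H d / (δ * m))
    have h5 := Int.lt_floor_add_one (H d / (δ * m))
    rw [h3] at h4 h5
    rw [le_div_iff₀ (by positivity)] at h4
    rw [div_lt_iff₀ (by positivity)] at h5
    rw [abs_le]
    constructor <;> linarith
  refine ⟨m, j * δ, D, ?_, ?_, fun d hd => ⟨hVG d (hDmem d hd).1, (hDmem d hd).2.1, hDH d hd⟩, ?_⟩
  · exact_mod_cast (by linarith : (M : ℝ) ≤ m)
  · have h1 := abs_le.mp (hDH d hd)
    have h2 := abs_le.mp (hH d (hG (hVG d hd1)))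
    rw [hd2] at h2
    have h3 : C ≤ C * m := le_mul_of_one_le_right hC (by linarith)
    have h4 : |j * δ| * m ≤ (B + C + 2 * δ) * m := by
      have h5 : 0 ≤ δ * m := by positivity
      have h6 : |j * δ| * m = |j * δ * m| := by rw [abs_mul (j * δ), abs_of_pos hm0]
      rw [h6, abs_le]
      constructor <;> linarith
    exact le_of_mul_le_mul_right h4 hm0
  · refine le_trans (Real.exp_le_exp.mpr ?_) hmain
    have h1 : |t * (m - n)| ≤ |t| * r := by
      rw [abs_mul]
      have : |(m : ℝ) - n| ≤ r := abs_le.mpr ⟨by linarith, by linarith⟩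
      gcongr
    have h2 := (abs_le.mp h1).2
    have h3 := mul_le_mul_of_nonneg_left hm2 hδ.le
    have h4 : 0 ≤ δ * n := by positivity
    linarith

/-! ### Concatenating blocks -/

/-- `x` starts with the word `c`, and then runs through the blocks `ω 0, ω 1, …` of length `m`,
the `k`-th one ending at time `T (k + 1)`, with gaps of total length at most `2 * τ` and a copy of
`c` inserted before the `k`-th block when `E k` holds. -/
structure Itinerary {α : Type} (x : ℕ → α) (c : List α) (E : ℕ → Prop) [DecidablePred E]
    (τ m : ℕ) (ω : ℕ → List α) (T : ℕ → ℕ) : Prop where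
  zero : T 0 = c.length
  lower : ∀ k, T k + (if E k then c.length else 0) + m ≤ T (k + 1)
  upper : ∀ k, T (k + 1) ≤ T k + (if E k then c.length else 0) + m + 2 * τ
  block : ∀ k, shift^[T (k + 1) - m] x ∈ cylinder (ω k)
  insertion : ∀ k, E k → ∃ j, T k ≤ j ∧ j + c.length + m ≤ T (k + 1) ∧
    shift^[j] x ∈ cylinder c

lemma exists_itinerary {α : Type} [Finite α] [TopologicalSpace α] [DiscreteTopology α]
    {X : Set (ℕ → α)} (hX : IsClosed X) {G : Set (List α)} (hG : G ⊆ language X) {τ : ℕ}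
    (hspec : ∀ v ∈ G, ∀ w ∈ G, ∃ u : List α, u.length ≤ τ ∧ v ++ u ++ w ∈ G)
    {c : List α} (hc : c ∈ G) (E : ℕ → Prop) [DecidablePred E] {m : ℕ} {ω : ℕ → List α}
    (hω : ∀ k, ω k ∈ G ∧ (ω k).length = m) :
    ∃ (x : X) (T : ℕ → ℕ), Itinerary x.val c E τ m ω T := by
  choose! u hu hglue using hspec
  let V : ℕ → List α := fun k => Nat.rec c (fun k v =>
    if E k then (v ++ u v c ++ c) ++ u (v ++ u v c ++ c) (ω k) ++ ω k
    else v ++ u v (ω k) ++ ω k) k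
  have hV : ∀ k, V (k + 1) =
      if E k then (V k ++ u (V k) c ++ c) ++ u (V k ++ u (V k) c ++ c) (ω k) ++ ω k
      else V k ++ u (V k) (ω k) ++ ω k := fun k => rfl
  have hVG : ∀ k, V k ∈ G := by
    intro k
    induction k with
    | zero => exact hc
    | succ k ih =>
      rw [hV]
      split_ifs
      · exact hglue _ (hglue _ ih _ hc) _ (hω k).1
      · exact hglue _ ih _ (hω k).1
  have hanti : ∀ k, cylinder (V (k + 1)) ∩ X ⊆ cylinder (V k) ∩ X := by
    rintro k x ⟨hx, hxX⟩
    refine ⟨?_, hxX⟩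
    rw [hV] at hx
    split_ifs at hx
    · simp only [List.append_assoc] at hx
      exact (mem_cylinder_append.mp hx).1
    · simp only [List.append_assoc] at hx
      exact (mem_cylinder_append.mp hx).1
  obtain ⟨x, hx⟩ := IsCompact.nonempty_iInter_of_sequence_nonempty_isCompact_isClosed
    (fun k => cylinder (V k) ∩ X) hanti (fun k => hG (hVG k))
    ((isClosed_cylinder _).inter hX).isCompact (fun k => (isClosed_cylinder _).inter hX)
  have hxV : ∀ k, x ∈ cylinder (V k) := fun k => (mem_iInter.mp hx k).1
  refine ⟨⟨x, (mem_iInter.mp hx 0).2⟩, fun k => (V k).length, rfl, fun k => ?_, fun k => ?_,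
    fun k => ?_, fun k hk => ?_⟩
  · rw [hV]
    split_ifs <;> simp only [List.length_append, (hω k).2] <;> omega
  · rw [hV]
    split_ifs
    · have h1 := hu _ (hVG k) _ hc
      have h2 := hu _ (hglue _ (hVG k) _ hc) _ (hω k).1
      simp only [List.length_append, (hω k).2]
      omega
    · have h1 := hu _ (hVG k) _ (hω k).1
      simp only [List.length_append, (hω k).2]
      omega
  · have h := hxV (k + 1)
    rw [hV] at h ⊢
    split_ifs at h ⊢ with hk
    · have h1 := (mem_cylinder_append.mp h).2
      rwa [List.length_append (bs := ω k), (hω k).2, Nat.add_sub_cancel]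
    · have h1 := (mem_cylinder_append.mp h).2
      rwa [List.length_append (bs := ω k), (hω k).2, Nat.add_sub_cancel]
  · have h := hxV (k + 1)
    rw [hV, if_pos hk] at h
    rw [hV, if_pos hk]
    refine ⟨(V k ++ u (V k) c).length, by simp, ?_, ?_⟩
    · simp only [List.length_append, (hω k).2]
      omega
    · rw [List.append_assoc _ _ (ω k)] at h
      exact (mem_cylinder_append.mp (mem_cylinder_append.mp h).1).2

namespace Itinerary

variable {α : Type} {x : ℕ → α} {c : List α} {E : ℕ → Prop} [DecidablePred E] {τ m : ℕ}
  {ω : ℕ → List α} {T : ℕ → ℕ}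

lemma monotone (h : Itinerary x c E τ m ω T) : Monotone T :=
  monotone_nat_of_le_succ fun k => by have := h.lower k; omega

lemma le_time (h : Itinerary x c E τ m ω T) (k : ℕ) :
    c.length + k * m + Nat.count E k * c.length ≤ T k := by
  induction k with
  | zero => simp [h.zero]
  | succ k ih =>
    have := h.lower k
    rw [Nat.count_succ]
    split_ifs at * <;> linarith

lemma time_le (h : Itinerary x c E τ m ω T) (k : ℕ) :
    T k ≤ c.length + k * (m + 2 * τ) + Nat.count E k * c.length := by
  induction k with
  | zero => simp [h.zero]
  | succ k ih =>
    have := h.upper k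
    rw [Nat.count_succ]
    split_ifs at * <;> linarith

/-- The blocks are determined by the point and by the times at which they end. -/
lemma block_eq {x' : ℕ → α} {ω' : ℕ → List α} {T' : ℕ → ℕ} (h : Itinerary x c E τ m ω T)
    (h' : Itinerary x' c E τ m ω' T') (hω : ∀ k, (ω k).length = m) (hω' : ∀ k, (ω' k).length = m)
    {n k : ℕ} (hx : ∀ i < n, x i = x' i) (hT : ∀ i ≤ k, T i = T' i) (hn : T k ≤ n) :
    ∀ i < k, ω i = ω' i := by
  intro i hi
  have h1 := mem_cylinder_iff.mp (h.block i)
  have h2 := mem_cylinder_iff.mp (h'.block i)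
  refine List.ext_getElem ((hω i).trans (hω' i).symm) fun j hj hj' => ?_
  have h3 := h1 j hj
  have h4 := h2 j hj'
  have h5 := h.monotone (show i + 1 ≤ k from hi)
  have h6 := h.lower i
  rw [shift_iterate_apply] at h3 h4
  rw [← h3, ← h4, ← hT _ hi]
  rw [hω i] at hj
  exact hx _ (by omega)

lemma abs_birkhoff_sub_le {X : Set (ℕ → α)} (hX : MapsTo shift X X) {x : X}
    (h : Itinerary x.val c E τ m ω T) (hω : ∀ k, (ω k).length = m) {f : X → ℝ} {ε C B : ℝ}
    {F : List α → ℝ} (hB : 0 ≤ B) (hf : ∀ y, |f y| ≤ B) (hF : WordApprox X f ε C F) (k : ℕ) :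
    |birkhoff (subShift X) f (T k) x - ∑ i ∈ Finset.range k, F (ω i) - Nat.count E k * F c| ≤
      B * c.length + k * (2 * τ * B + ε * m + C) + Nat.count E k * (ε * c.length + C) := by
  induction k with
  | zero =>
    have := abs_birkhoff_le (subShift X) hf (T 0) x
    simpa [h.zero] using this
  | succ k ih =>
    have hlow := h.lower k
    have hup := h.upper k
    have hb : |birkhoff (subShift X) f m ((subShift X)^[T (k + 1) - m] x) - F (ω k)| ≤
        ε * m + C := by
      have := hF.approx (ω k) ((subShift X)^[T (k + 1) - m] x)
        (by rw [subShift_iterate_val hX]; exact h.block k)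
      rwa [hω k] at this
    have hgap : ∀ a b : ℕ, a + b ≤ 2 * τ → ∀ y z, |birkhoff (subShift X) f a y| +
        |birkhoff (subShift X) f b z| ≤ 2 * τ * B := by
      intro a b hab y z
      have h1 := abs_birkhoff_le (subShift X) hf a y
      have h2 := abs_birkhoff_le (subShift X) hf b z
      have h3 : ((a : ℝ) + b) ≤ 2 * τ := by exact_mod_cast hab
      nlinarith
    rw [Finset.sum_range_succ, Nat.count_succ]
    by_cases hE : E k
    · obtain ⟨j, hj1, hj2, hj3⟩ := h.insertion k hE
      rw [if_pos hE] at hlow hup ⊢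
      have hc := hF.approx c ((subShift X)^[j] x) (by rw [subShift_iterate_val hX]; exact hj3)
      obtain ⟨a, rfl⟩ := Nat.exists_eq_add_of_le hj1
      obtain ⟨b, hb'⟩ := Nat.exists_eq_add_of_le hj2
      have e1 : T (k + 1) - m = T k + a + c.length + b := by omega
      have e2 : T (k + 1) = T k + a + c.length + b + m := by omega
      rw [e1] at hb
      have hg := hgap a b (by omega) ((subShift X)^[T k] x)
        ((subShift X)^[T k + a + c.length] x)
      rw [e2]
      simp only [birkhoff_add]
      push_cast
      generalize birkhoff (subShift X) f m _ = s1 at *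
      generalize birkhoff (subShift X) f b _ = s2 at *
      generalize birkhoff (subShift X) f c.length _ = s3 at *
      generalize birkhoff (subShift X) f a _ = s4 at *
      have := abs_le.mp ih
      have := abs_le.mp hb
      have := abs_le.mp hc
      have := neg_abs_le s2
      have := le_abs_self s2
      have := neg_abs_le s4
      have := le_abs_self s4
      rw [abs_le]
      constructor <;> linarith
    · rw [if_neg hE] at hlow hup ⊢
      obtain ⟨a, ha⟩ := Nat.exists_eq_add_of_le hlow
      have e1 : T (k + 1) - m = T k + a := by omega
      have e2 : T (k + 1) = T k + a + m := by omega
      rw [e1] at hb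
      have hg := hgap a 0 (by omega) ((subShift X)^[T k] x) x
      rw [e2]
      simp only [birkhoff_add]
      push_cast
      generalize birkhoff (subShift X) f m _ = s1 at *
      generalize birkhoff (subShift X) f a _ = s4 at *
      have := abs_le.mp ih
      have := abs_le.mp hb
      have := neg_abs_le s4
      have := le_abs_self s4
      have := abs_nonneg (birkhoff (subShift X) f 0 x)
      rw [abs_le]
      constructor <;> linarith

end Itinerary

/-! ### Oscillating sets of positions -/

/-- The multiples `i` of `q` for which `i / q` lies in some `[4 ^ (2 * j), 4 ^ (2 * j + 1))`. -/
def OscAt (q i : ℕ) : Prop := q ∣ i ∧ Even (Nat.log 4 (i / q))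

instance (q : ℕ) : DecidablePred (OscAt q) := fun _ => inferInstanceAs (Decidable (_ ∧ _))

lemma count_oscAt_mul {q : ℕ} (hq : 0 < q) (K : ℕ) :
    Nat.count (OscAt q) (q * K) = Nat.count (fun j => Even (Nat.log 4 j)) K := by
  induction K with
  | zero => simp
  | succ K ih =>
    obtain ⟨q, rfl⟩ := Nat.exists_eq_succ_of_ne_zero hq.ne'
    have h0 : Nat.count (fun k => OscAt q.succ (q.succ * K + (k + 1))) q = 0 := by
      refine Nat.count_of_forall_not fun j hj h => ?_
      have := (Nat.dvd_add_right (dvd_mul_right _ _)).mp h.1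
      exact absurd (Nat.le_of_dvd (by omega) this) (by simp; omega)
    have h1 : OscAt q.succ (q.succ * K + 0) ↔ Even (Nat.log 4 K) := by simp [OscAt]
    rw [mul_add, mul_one, Nat.count_add, ih, Nat.count_succ _ K, Nat.count_succ', h0, zero_add]
    simp only [h1]

lemma count_oscAt_le {q : ℕ} (hq : 0 < q) (k : ℕ) : Nat.count (OscAt q) k ≤ k / q + 1 := by
  have h1 : k ≤ q * (k / q + 1) := (Nat.lt_mul_div_succ k hq).le
  calc _ ≤ Nat.count (OscAt q) (q * (k / q + 1)) := Nat.count_monotone _ h1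
    _ = _ := count_oscAt_mul hq _
    _ ≤ _ := Nat.count_le _

lemma count_oscAt_even_pow {q : ℕ} (hq : 0 < q) (i : ℕ) :
    4 * Nat.count (OscAt q) (q * 4 ^ (2 * i + 2)) ≤ 4 ^ (2 * i + 2) := by
  rw [count_oscAt_mul hq]
  have h : (4 : ℕ) ^ (2 * i + 2) = 4 ^ (2 * i + 1) + 3 * 4 ^ (2 * i + 1) := by ring
  have h2 : Nat.count (fun j => Even (Nat.log 4 j)) (4 ^ (2 * i + 2)) ≤ 4 ^ (2 * i + 1) := by
    rw [h, Nat.count_add, Nat.count_of_forall_not (n := 3 * _)]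
    · exact Nat.count_le _
    · intro j hj
      rw [Nat.log_eq_of_pow_le_of_lt_pow (m := 2 * i + 1) (by omega)
        (by rw [pow_succ]; omega)]
      simp [parity_simps]
  calc _ ≤ 4 * 4 ^ (2 * i + 1) := by omega
    _ = _ := by ring

lemma count_oscAt_odd_pow {q : ℕ} (hq : 0 < q) (i : ℕ) :
    3 * 4 ^ (2 * i + 1) ≤ 4 * Nat.count (OscAt q) (q * 4 ^ (2 * i + 1)) := by
  rw [count_oscAt_mul hq]
  have h : (4 : ℕ) ^ (2 * i + 1) = 4 ^ (2 * i) + 3 * 4 ^ (2 * i) := by ring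
  have h2 : 3 * 4 ^ (2 * i) ≤ Nat.count (fun j => Even (Nat.log 4 j)) (4 ^ (2 * i + 1)) := by
    rw [h, Nat.count_add]
    refine le_trans ?_ (Nat.le_add_left _ _)
    refine (Nat.count_iff_forall.mpr fun j hj => ?_).ge
    rw [Nat.log_eq_of_pow_le_of_lt_pow (m := 2 * i) (by omega) (by rw [pow_succ]; omega)]
    simp
  omega

/-- A sequence of sums sampled along times at which a perturbation of frequency oscillating
between at most `1 / 4` and at least `3 / 4` has been added does not have converging averages. -/
lemma not_tendsto_of_oscAt {S : ℕ → ℝ} {T : ℕ → ℕ} {q m ℓ : ℕ} (hq : 0 < q) (hm : 0 < m)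
    {γ Δ σ K : ℝ} (hσ0 : 0 < σ) (hσ : σ ≤ 1 / 8) (hℓ : 4 * ℓ ≤ q * m)
    (hΔ : 24 * σ * (q * m) < |Δ|) (hT1 : ∀ k, k * m ≤ T k)
    (hT2 : ∀ k, (T k : ℝ) ≤ k * m + Nat.count (OscAt q) k * ℓ + K + σ * (k * m))
    (hS : ∀ k, |S (T k) - γ * T k - Nat.count (OscAt q) k * Δ| ≤ K + σ * (k * m)) :
    ¬ ∃ α : ℝ, Tendsto (fun n : ℕ => (n : ℝ)⁻¹ * S n) atTop (𝓝 α) := by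
  rintro ⟨α, hα⟩
  have hm' : (1 : ℝ) ≤ m := by exact_mod_cast hm
  have hq' : (1 : ℝ) ≤ q := by exact_mod_cast hq
  have hℓ' : 4 * (ℓ : ℝ) ≤ q * m := by exact_mod_cast hℓ
  have hqm : 0 < (q : ℝ) * m := by positivity
  have hT1' : ∀ k : ℕ, (k : ℝ) * m ≤ T k := fun k => by exact_mod_cast hT1 k
  have hTtop : Tendsto (fun N => T (q * N)) atTop atTop := by
    refine tendsto_atTop_mono (fun N => ?_) tendsto_id
    calc N ≤ q * N * m := by nlinarith [Nat.mul_le_mul hq hm, Nat.zero_le N]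
      _ ≤ _ := hT1 _
  have hev : ∀ᶠ N : ℕ in atTop, 0 < (N : ℝ) ∧ (N : ℝ) * (q * m) ≤ T (q * N) ∧
      (T (q * N) : ℝ) ≤ 3 / 2 * (N * (q * m)) ∧
      |(γ - α) * T (q * N) + Nat.count (OscAt q) (q * N) * Δ| ≤ 7 / 2 * σ * (N * (q * m)) := by
    have h1 := (Metric.tendsto_nhds.mp (hα.comp hTtop)) σ hσ0
    have h2 : ∀ᶠ N : ℕ in atTop, K / (σ * (q * m)) ≤ (N : ℝ) :=
      tendsto_natCast_atTop_atTop.eventually_ge_atTop _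
    filter_upwards [h1, h2, eventually_gt_atTop 0] with N h1 h2 h3
    have hN : (0 : ℝ) < N := by exact_mod_cast h3
    have hP : 0 < (N : ℝ) * (q * m) := by positivity
    rw [div_le_iff₀ (by positivity)] at h2
    have hTlow := hT1' (q * N)
    have hTup := hT2 (q * N)
    have hSk := abs_le.mp (hS (q * N))
    push_cast at hTlow hTup hSk
    have he : (Nat.count (OscAt q) (q * N) : ℝ) ≤ N := by
      rw [count_oscAt_mul hq]
      exact_mod_cast Nat.count_le _
    have he' : (Nat.count (OscAt q) (q * N) : ℝ) * ℓ ≤ N * ℓ := by gcongr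
    have hNℓ : (N : ℝ) * ℓ ≤ N * (q * m) / 4 := by nlinarith
    have hσP : σ * (N * (q * m)) ≤ 1 / 8 * (N * (q * m)) := by gcongr
    have hT3 : (T (q * N) : ℝ) ≤ 3 / 2 * (N * (q * m)) := by linarith
    have hT0 : (0 : ℝ) < T (q * N) := by linarith
    rw [Function.comp_apply, Real.dist_eq] at h1
    have h4 : |S (T (q * N)) - α * T (q * N)| ≤ σ * T (q * N) := by
      have : S (T (q * N)) - α * T (q * N) =
          ((T (q * N) : ℝ)⁻¹ * S (T (q * N)) - α) * T (q * N) := by field_simp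
      rw [this, abs_mul, abs_of_pos hT0]
      gcongr
    have h5 := abs_le.mp h4
    have h6 : σ * T (q * N) ≤ σ * (3 / 2 * (N * (q * m))) := by gcongr
    refine ⟨hN, by linarith, hT3, ?_⟩
    rw [abs_le]
    constructor <;> linarith
  obtain ⟨N₀, hN₀⟩ := eventually_atTop.mp hev
  have hpow : ∀ i, N₀ ≤ i → N₀ ≤ 4 ^ i := fun i hi =>
    hi.trans (Nat.lt_pow_self (by norm_num)).le
  obtain ⟨hN, hT3, hT4, h1⟩ := hN₀ _ (hpow (2 * N₀ + 2) (by omega))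
  obtain ⟨hN', hT3', hT4', h1'⟩ := hN₀ _ (hpow (2 * N₀ + 1) (by omega))
  have he : 4 * (Nat.count (OscAt q) (q * 4 ^ (2 * N₀ + 2)) : ℝ) ≤ (4 ^ (2 * N₀ + 2) : ℕ) := by
    exact_mod_cast count_oscAt_even_pow hq N₀
  have he' : 3 * ((4 ^ (2 * N₀ + 1) : ℕ) : ℝ) ≤
      4 * Nat.count (OscAt q) (q * 4 ^ (2 * N₀ + 1)) := by
    exact_mod_cast count_oscAt_odd_pow hq N₀
  generalize ((4 ^ (2 * N₀ + 2) : ℕ) : ℝ) = N at *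
  generalize ((4 ^ (2 * N₀ + 1) : ℕ) : ℝ) = N' at *
  generalize (T (q * 4 ^ (2 * N₀ + 2)) : ℝ) = t at *
  generalize (T (q * 4 ^ (2 * N₀ + 1)) : ℝ) = t' at *
  have hc : (0 : ℝ) ≤ (Nat.count (OscAt q) (q * 4 ^ (2 * N₀ + 2)) : ℝ) := by positivity
  have hc' : (0 : ℝ) ≤ (Nat.count (OscAt q) (q * 4 ^ (2 * N₀ + 1)) : ℝ) := by positivity
  generalize (Nat.count (OscAt q) (q * 4 ^ (2 * N₀ + 2)) : ℝ) = e at *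
  generalize (Nat.count (OscAt q) (q * 4 ^ (2 * N₀ + 1)) : ℝ) = e' at *
  have hP : 0 ≤ N * (q * m) := by positivity
  have hP' : 0 ≤ N' * (q * m) := by positivity
  have h2 : |γ - α| * (q * m) ≤ |Δ| / 4 + 7 / 2 * σ * (q * m) := by
    have h3 : |γ - α| * t ≤ e * |Δ| + 7 / 2 * σ * (N * (q * m)) := by
      calc |γ - α| * t = |(γ - α) * t| := by rw [abs_mul, abs_of_nonneg (hP.trans hT3)]
        _ = |((γ - α) * t + e * Δ) - e * Δ| := by ring_nf
        _ ≤ |(γ - α) * t + e * Δ| + |e * Δ| := abs_sub _ _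
        _ ≤ _ := by rw [abs_mul e, abs_of_nonneg hc]; linarith
    have h4 : |γ - α| * (N * (q * m)) ≤ |γ - α| * t := by gcongr
    have h5 : e * |Δ| ≤ N / 4 * |Δ| := by gcongr; linarith
    refine le_of_mul_le_mul_left ?_ hN
    linarith
  have h2' : 3 / 4 * |Δ| ≤ 3 / 2 * (|γ - α| * (q * m)) + 7 / 2 * σ * (q * m) := by
    have h3 : e' * |Δ| ≤ |γ - α| * t' + 7 / 2 * σ * (N' * (q * m)) := by
      calc e' * |Δ| = |e' * Δ| := by rw [abs_mul, abs_of_nonneg hc']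
        _ = |((γ - α) * t' + e' * Δ) - (γ - α) * t'| := by ring_nf
        _ ≤ |(γ - α) * t' + e' * Δ| + |(γ - α) * t'| := abs_sub _ _
        _ ≤ _ := by rw [abs_mul (γ - α), abs_of_nonneg (hP'.trans hT3')]; linarith
    have h4 : |γ - α| * t' ≤ |γ - α| * (3 / 2 * (N' * (q * m))) := by gcongr
    have h5 : 3 / 4 * N' * |Δ| ≤ e' * |Δ| := by gcongr; linarith
    refine le_of_mul_le_mul_left ?_ hN'
    linarith
  have h3 : 0 < σ * (q * m) := by positivity
  linarith

/-! ### Mass distribution -/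

lemma infinitePi_le_pow_mul {β : Type} [Countable β] [MeasurableSpace β]
    [MeasurableSingletonClass β] (μ : Measure β) [IsProbabilityMeasure μ] (Y : Set (ℕ → β))
    {k R : ℕ} (L : (ℕ → β) → Fin k → Fin R)
    (hL : ∀ ω ∈ Y, ∀ ω' ∈ Y, L ω = L ω' → ∀ i < k, ω i = ω' i) {K : ℝ≥0∞}
    (hK : ∀ ω ∈ Y, ∏ i ∈ Finset.range k, μ {ω i} ≤ K) :
    Measure.infinitePi (fun _ : ℕ => μ) Y ≤ R ^ k * K := by
  have hcover : Y ⊆ ⋃ l : Fin k → Fin R, {ω ∈ Y | L ω = l} := fun ω hω =>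
    mem_iUnion.mpr ⟨L ω, hω, rfl⟩
  have hpiece : ∀ l, Measure.infinitePi (fun _ : ℕ => μ) {ω ∈ Y | L ω = l} ≤ K := by
    intro l
    rcases eq_empty_or_nonempty {ω ∈ Y | L ω = l} with h | ⟨ω₀, hω₀, hl₀⟩
    · simp [h]
    · have hsub : {ω ∈ Y | L ω = l} ⊆
          Set.pi (Finset.range k : Set ℕ) fun i => ({ω₀ i} : Set β) := by
        rintro ω ⟨hω, hl⟩ i hi
        exact hL ω hω ω₀ hω₀ (hl.trans hl₀.symm) i (by simpa using hi)
      refine (measure_mono hsub).trans ?_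
      rw [Measure.infinitePi_pi _ fun i _ => measurableSet_singleton _]
      exact hK ω₀ hω₀
  calc _ ≤ _ := measure_mono hcover
    _ ≤ ∑' l : Fin k → Fin R, Measure.infinitePi (fun _ : ℕ => μ) {ω ∈ Y | L ω = l} :=
      measure_iUnion_le _
    _ ≤ ∑' _ : Fin k → Fin R, K := ENNReal.tsum_le_tsum hpiece
    _ = _ := by rw [tsum_fintype]; simp

lemma ofReal_exp_neg_le_Mcal {α Ω : Type} [MeasurableSpace Ω] (ν : Measure Ω)
    [IsProbabilityMeasure ν] {X : Set (ℕ → α)} {f : X → ℝ} {Z : Set X} {x : Ω → X}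
    (hx : ∀ ω, x ω ∈ Z) {t K : ℝ} {N : ℕ}
    (hν : ∀ w : List α, N < w.length → ν {ω | (x ω).val ∈ cylinder w} ≤
      ENNReal.ofReal (Real.exp (K + (-t * w.length +
        sSup (birkhoff (subShift X) f w.length '' (Subtype.val ⁻¹' cylinder w)))))) :
    ENNReal.ofReal (Real.exp (-K)) ≤ Mcal X f Z t N := by
  refine le_iInf fun S => le_iInf fun hS => le_iInf fun hN => le_iInf fun hcov => ?_
  have h1 : (1 : ℝ≥0∞) ≤ ENNReal.ofReal (Real.exp K) *
      ∑' w : S, ENNReal.ofReal (Real.exp (-t * (w : List α).length +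
      sSup (birkhoff (subShift X) f (w : List α).length ''
        (Subtype.val ⁻¹' cylinder (w : List α))))) := by
    calc (1 : ℝ≥0∞) = ν univ := measure_univ.symm
      _ ≤ ν (⋃ w ∈ S, {ω | (x ω).val ∈ cylinder w}) := by
        refine measure_mono fun ω _ => ?_
        have := hcov (hx ω)
        simpa using this
      _ ≤ ∑' w : S, ν {ω | (x ω).val ∈ cylinder (w : List α)} := measure_biUnion_le _ hS _
      _ ≤ ∑' w : S, ENNReal.ofReal (Real.exp K) *
          ENNReal.ofReal (Real.exp (-t * (w : List α).length +
          sSup (birkhoff (subShift X) f (w : List α).length ''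
            (Subtype.val ⁻¹' cylinder (w : List α))))) := by
        refine ENNReal.tsum_le_tsum fun w => (hν w (hN w w.2)).trans ?_
        rw [← ENNReal.ofReal_mul (Real.exp_pos _).le, ← Real.exp_add]
      _ = _ := ENNReal.tsum_mul_left
  rw [← mul_one (ENNReal.ofReal (Real.exp (-K)))]
  refine (mul_le_mul' le_rfl h1).trans_eq ?_
  rw [← mul_assoc, ← ENNReal.ofReal_mul (Real.exp_pos _).le, ← Real.exp_add]
  simp

namespace Itinerary

variable {α : Type} {c : List α} {τ m : ℕ}

lemma time_eq {x x' : ℕ → α} {E : ℕ → Prop} [DecidablePred E] {ω ω' : ℕ → List α} {T T' : ℕ → ℕ}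
    (h : Itinerary x c E τ m ω T) (h' : Itinerary x' c E τ m ω' T') {k : ℕ}
    (hT : ∀ i < k, T (i + 1) - T i - m - (if E i then c.length else 0) =
      T' (i + 1) - T' i - m - (if E i then c.length else 0)) : ∀ i ≤ k, T i = T' i := by
  intro i
  induction i with
  | zero => intro _; rw [h.zero, h'.zero]
  | succ i ih =>
    intro hi
    have h1 := ih (by omega)
    have h2 := hT i (by omega)
    have h3 := h.lower i
    have h4 := h'.lower i
    omega

/-- If the copies of `c` take up a small proportion of the time, then the Birkhoff sums are
controlled from below by the blocks. -/
lemma sum_le_birkhoff {X : Set (ℕ → α)} (hX : MapsTo shift X X) {x : X} {q : ℕ} (hq : 0 < q)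
    {ω : ℕ → List α} {T : ℕ → ℕ} (h : Itinerary x.val c (OscAt q) τ m ω T)
    (hω : ∀ k, (ω k).length = m) (hm : 0 < m) {f : X → ℝ} {δ C B η t t₂ : ℝ} {F : List α → ℝ}
    (hB : 0 ≤ B) (hC : 0 ≤ C) (hf : ∀ y, |f y| ≤ B) (hF : WordApprox X f δ C F)
    (hc : c ∈ language X) (hδ : 0 ≤ δ) (hδη : δ ≤ η) (hη : η ≤ 1 / 8)
    (hτ : 2 * τ ≤ η * m) (hτB : 2 * τ * B + 3 * C ≤ η * m) (hcq : c.length ≤ η * (q * m))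
    (ht : (3 * B + 4 + 2 * |t₂|) * η ≤ t₂ - t) {n : ℕ} (hn : 2 * c.length ≤ n) {k : ℕ}
    (hk : k = ⌊((n : ℝ) - 2 * c.length) / (m * (1 + 2 * η))⌋₊) :
    T k ≤ n ∧ k * (η * m) + (∑ i ∈ Finset.range k, F (ω i) - k * (t₂ * m)) ≤
      (4 * B + 1) * c.length + 2 * C + (B + |t₂|) * (2 * c.length + 2 * m) +
        (-t * n + birkhoff (subShift X) f n x) := by
  have hη0 : 0 ≤ η := hδ.trans hδη
  have hm0 : (0 : ℝ) < m := by exact_mod_cast hm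
  have hq0 : (0 : ℝ) < q := by exact_mod_cast hq
  have hn' : 2 * (c.length : ℝ) ≤ n := by exact_mod_cast hn
  have hden : 0 < (m : ℝ) * (1 + 2 * η) := by positivity
  have hk1 : (k : ℝ) * (m * (1 + 2 * η)) ≤ n - 2 * c.length := by
    rw [← le_div_iff₀ hden, hk]
    exact Nat.floor_le (div_nonneg (by linarith) hden.le)
  have hk2 : (n : ℝ) - 2 * c.length < (k + 1) * (m * (1 + 2 * η)) := by
    rw [← div_lt_iff₀ hden, hk]
    exact Nat.lt_floor_add_one _
  set e : ℝ := ((Nat.count (OscAt q) k : ℕ) : ℝ) with he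
  have he0 : 0 ≤ e := by positivity
  have he1 : e ≤ k / q + 1 := by
    have h1 : e ≤ ((k / q : ℕ) : ℝ) + 1 := by rw [he]; exact_mod_cast count_oscAt_le hq k
    exact h1.trans (by gcongr; exact Nat.cast_div_le)
  have he2 : e ≤ k + 1 := by
    refine he1.trans ?_
    gcongr
    exact div_le_self (by positivity) (by exact_mod_cast hq)
  set ℓ : ℝ := ((c.length : ℕ) : ℝ) with hℓ
  have hℓ0 : 0 ≤ ℓ := by positivity
  have heℓ : e * ℓ ≤ k * (η * m) + ℓ := by
    calc e * ℓ ≤ (k / q + 1) * ℓ := by gcongr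
      _ = k / q * ℓ + ℓ := by ring
      _ ≤ k / q * (η * (q * m)) + ℓ := by gcongr
      _ = _ := by field_simp
  have hTlow : ℓ + k * m + e * ℓ ≤ T k := by
    rw [he, hℓ]
    exact_mod_cast h.le_time k
  have hTup : (T k : ℝ) ≤ ℓ + k * (m + 2 * τ) + e * ℓ := by
    rw [he, hℓ]
    exact_mod_cast h.time_le k
  have hkτ : (k : ℝ) * (2 * τ) ≤ k * (η * m) := by gcongr
  have hTn : T k ≤ n := by
    have : (T k : ℝ) ≤ n := by linarith
    exact_mod_cast this
  refine ⟨hTn, ?_⟩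
  obtain ⟨b, hb⟩ := Nat.exists_eq_add_of_le hTn
  have hb' : (n : ℝ) = T k + b := by exact_mod_cast hb
  have hS : birkhoff (subShift X) f n x = birkhoff (subShift X) f (T k) x +
      birkhoff (subShift X) f b ((subShift X)^[T k] x) := by rw [hb, birkhoff_add]
  have hS1 := (abs_le.mp (abs_birkhoff_le (subShift X) hf b ((subShift X)^[T k] x))).1
  have hS2 := (abs_le.mp (h.abs_birkhoff_sub_le hX hω hB hf hF k)).1
  rw [← he, ← hℓ] at hS2
  have hFc : -(e * ((B + δ) * ℓ + C)) ≤ e * F c := by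
    have := (abs_le.mp (hF.abs_le hf hc)).1
    calc _ = e * -((B + δ) * ℓ + C) := by ring
      _ ≤ _ := by gcongr
  have hkm : 0 ≤ (k : ℝ) * m := by positivity
  have hb2 : (b : ℝ) ≤ n - k * m := by
    have : 0 ≤ e * ℓ := by positivity
    linarith
  have hηm : η * m ≤ 1 / 8 * m := by gcongr
  have hnkm : (n : ℝ) - k * m ≤ 2 * ℓ + 2 * m + 2 * (k * (η * m)) := by linarith
  have hBb : B * b ≤ B * (2 * ℓ + 2 * m + 2 * (k * (η * m))) := by gcongr; linarith
  have ht2 : |t₂| * (n - k * m) ≤ |t₂| * (2 * ℓ + 2 * m + 2 * (k * (η * m))) := by gcongr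
  have ht3 : t₂ * (n - k * m) ≤ |t₂| * (n - k * m) := by
    have : 0 ≤ (n : ℝ) - k * m := by
      have : (0 : ℝ) ≤ b := by positivity
      linarith
    gcongr
    exact le_abs_self _
  have h1 : (B + 2 * δ) * (e * ℓ) ≤ (B + 1) * (k * (η * m) + ℓ) - (k * (η * m) + ℓ) / 2 := by
    have : B + 2 * δ ≤ B + 1 / 2 := by linarith
    calc _ ≤ (B + 1 / 2) * (k * (η * m) + ℓ) := by gcongr
      _ ≤ _ := by linarith
  have h2 : (k : ℝ) * (2 * τ * B + 3 * C) ≤ k * (η * m) := by gcongr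
  have h3 : (k : ℝ) * (δ * m) ≤ k * (η * m) := by gcongr
  have h4 : 2 * C * e ≤ 2 * C * (k + 1) := by gcongr
  have h5 : (3 * B + 4 + 2 * |t₂|) * (k * (η * m)) ≤ (t₂ - t) * n := by
    have h6 : (k : ℝ) * m ≤ n := by linarith [(by positivity : (0 : ℝ) ≤ b)]
    have h7 : 0 ≤ t₂ - t := le_trans (by positivity) ht
    calc _ = (3 * B + 4 + 2 * |t₂|) * η * (k * m) := by ring
      _ ≤ (t₂ - t) * (k * m) := by gcongr
      _ ≤ _ := by gcongr
  have h6 : 0 ≤ k * (η * m) := by positivity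
  have h7 : 0 ≤ B * ℓ := by positivity
  rw [hS]
  linarith

end Itinerary

/-! ### Irregular points with large pressure -/

lemma Itinerary.mem_irregular {α : Type} {X : Set (ℕ → α)} (hX : MapsTo shift X X) {x : X}
    {c : List α} {τ m q : ℕ} (hq : 0 < q) (hm : 0 < m) {ω : ℕ → List α} {T : ℕ → ℕ}
    (h : Itinerary x.val c (OscAt q) τ m ω T) (hω : ∀ k, (ω k).length = m) {f : X → ℝ}
    {δ C B η κ γ : ℝ} {F : List α → ℝ} (hB : 0 ≤ B) (hC : 0 ≤ C) (hf : ∀ y, |f y| ≤ B)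
    (hF : WordApprox X f δ C F) (hγ : ∀ k, |F (ω k) - γ * m| ≤ δ * m) (hδ : 0 < δ)
    (hδ' : δ ≤ 1 / 32) (hη0 : 0 < η) (hη : η ≤ 1 / 8) (hδκ : 200 * δ ≤ κ * η)
    (hτ : 2 * τ ≤ δ * m) (hτB : 2 * τ * (B + |γ|) + 3 * C ≤ δ * m) (hc : 0 < c.length)
    (hcq : c.length ≤ η * (q * m)) (hqc : η * (q * m) ≤ 2 * c.length)
    (hcγ : κ * c.length ≤ |F c - γ * c.length|) : x ∈ irregular (subShift X) f := by
  have hm0 : (0 : ℝ) < m := by exact_mod_cast hm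
  have hq0 : (0 : ℝ) < q := by exact_mod_cast hq
  have hqm : 0 < (q : ℝ) * m := by positivity
  have hℓ0 : (0 : ℝ) < c.length := by exact_mod_cast hc
  refine not_tendsto_of_oscAt (S := fun n => birkhoff (subShift X) f n x) (T := T)
    (ℓ := c.length) (γ := γ) (Δ := F c - γ * c.length) (σ := 4 * δ)
    (K := (B + |γ| + 1) * c.length + C) hq hm (by linarith) (by linarith) ?_ ?_ ?_ ?_ ?_
  · have : 4 * (c.length : ℝ) ≤ q * m := by
      have : η * (q * m) ≤ 1 / 8 * (q * m) := by gcongr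
      linarith
    exact_mod_cast this
  · refine lt_of_lt_of_le ?_ hcγ
    have h1 : 200 * δ * (η * (q * m)) ≤ 200 * δ * (2 * c.length) := by gcongr
    have h2 : 200 * δ * c.length ≤ κ * η * c.length := by gcongr
    have h3 : 0 < δ * c.length := by positivity
    have h4 : 96 * δ * (q * m) * η < κ * c.length * η := by linarith
    have := lt_of_mul_lt_mul_right h4 hη0.le
    linarith
  · intro k
    have := h.le_time k
    omega
  all_goals
    intro k
    have hTlow : (c.length : ℝ) + k * m + (Nat.count (OscAt q) k : ℕ) * c.length ≤ T k := by
      exact_mod_cast h.le_time k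
    have hTup : (T k : ℝ) ≤ c.length + k * (m + 2 * τ) +
        (Nat.count (OscAt q) k : ℕ) * c.length := by
      exact_mod_cast h.time_le k
    have hS := h.abs_birkhoff_sub_le hX hω hB hf hF k
    have he1 : (Nat.count (OscAt q) k : ℝ) ≤ k / q + 1 := by
      have h1 : (Nat.count (OscAt q) k : ℝ) ≤ ((k / q : ℕ) : ℝ) + 1 := by
        exact_mod_cast count_oscAt_le hq k
      exact h1.trans (by gcongr; exact Nat.cast_div_le)
    have he0 : (0 : ℝ) ≤ (Nat.count (OscAt q) k : ℝ) := by positivity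
    generalize (Nat.count (OscAt q) k : ℝ) = e at *
    have he2 : e ≤ k + 1 := by
      refine he1.trans ?_
      gcongr
      exact div_le_self (by positivity) (by exact_mod_cast hq)
    have heℓ : e * c.length ≤ k * (η * m) + c.length := by
      calc e * c.length ≤ (k / q + 1) * c.length := by gcongr
        _ = k / q * c.length + c.length := by ring
        _ ≤ k / q * (η * (q * m)) + c.length := by gcongr
        _ = _ := by field_simp
    have hkτ : (k : ℝ) * (2 * τ) ≤ k * (δ * m) := by gcongr
    have hkm : 0 ≤ (k : ℝ) * m := by positivity
  · have h1 : 0 ≤ (B + |γ|) * c.length := by positivity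
    have h2 : 0 ≤ δ * (k * m) := by positivity
    linarith
  · have hsum : |∑ i ∈ Finset.range k, F (ω i) - k * (γ * m)| ≤ k * (δ * m) := by
      have : ∑ i ∈ Finset.range k, F (ω i) - k * (γ * m) =
          ∑ i ∈ Finset.range k, (F (ω i) - γ * m) := by simp [Finset.sum_sub_distrib]
      rw [this]
      refine (Finset.abs_sum_le_sum_abs _ _).trans ((Finset.sum_le_sum fun i _ => hγ i).trans ?_)
      simp
    have hγT : |γ * (T k - k * m - e * c.length)| ≤ |γ| * (c.length + k * (2 * τ)) := by
      rw [abs_mul]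
      gcongr
      rw [abs_le]
      have : 0 ≤ (k : ℝ) * (2 * τ) := by positivity
      constructor <;> linarith
    have h1 : e * (δ * c.length + C) ≤ δ * (k * (η * m) + c.length) + C * (k + 1) := by
      have h2 : δ * (e * c.length) ≤ δ * (k * (η * m) + c.length) := by gcongr
      have h3 : C * e ≤ C * (k + 1) := by gcongr
      linarith
    have h2 : (k : ℝ) * (2 * τ * (B + |γ|) + 3 * C) ≤ k * (δ * m) := by gcongr
    have h3 : δ * (k * (η * m)) ≤ 1 / 8 * (δ * (k * m)) := by
      calc _ = η * (δ * (k * m)) := by ring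
        _ ≤ _ := by gcongr
    have h4 : δ * c.length ≤ 1 * c.length := by gcongr; linarith
    have h5 : 0 ≤ C * k := by positivity
    have h6 : 0 ≤ δ * (k * m) := by positivity
    have := abs_le.mp hS
    have := abs_le.mp hsum
    have := abs_le.mp hγT
    rw [abs_le]
    constructor <;> linarith

set_option maxHeartbeats 1000000 in
lemma exists_Mcal_irregular_ne_zero {α : Type} [Finite α] [TopologicalSpace α]
    [DiscreteTopology α] {X : Set (ℕ → α)} (hXcl : IsClosed X) (hX : MapsTo shift X X)
    {G : Set (List α)} (hG : G ⊆ language X) {τ : ℕ}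
    (hspec : ∀ v ∈ G, ∀ w ∈ G, ∃ u : List α, u.length ≤ τ ∧ v ++ u ++ w ∈ G)
    {φ ψ : X → ℝ} {δ C B η κ γ t t₂ : ℝ} {F H : List α → ℝ} (hB : 0 ≤ B) (hC : 0 ≤ C)
    (hφ : ∀ y, |φ y| ≤ B) (hψ : ∀ y, |ψ y| ≤ B) (hF : WordApprox X φ δ C F)
    (hH : WordApprox X ψ δ C H) {m : ℕ} (hm : 0 < m) {D : Finset (List α)}
    (hD : ∀ d ∈ D, d ∈ G ∧ d.length = m ∧ |H d - γ * m| ≤ δ * m)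
    (hDsum : Real.exp (t₂ * m) ≤ ∑ d ∈ D, Real.exp (F d)) (hδ : 0 < δ)
    (hδ' : δ ≤ 1 / 32) (hδη : δ ≤ η) (hη : η ≤ 1 / 8) (hδκ : 200 * δ ≤ κ * η)
    (hτ : 2 * τ ≤ δ * m) (hτB : 2 * τ * (B + |γ|) + 3 * C ≤ δ * m)
    (hτexp : 2 * τ + 1 ≤ Real.exp (η * m))
    (ht : (3 * B + 4 + 2 * |t₂|) * η ≤ t₂ - t)
    {c : List α} (hc : c ∈ G) (hmc : η * m ≤ c.length)
    (hcγ : κ * c.length ≤ |H c - γ * c.length|) :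
    ∃ N, Mcal X φ (irregular (subShift X) ψ) t N ≠ 0 := by
  have hη0 : 0 < η := hδ.trans_le hδη
  have hm0 : (0 : ℝ) < m := by exact_mod_cast hm
  have hηm : 0 < η * m := by positivity
  have hc0 : (0 : ℝ) < c.length := hηm.trans_le hmc
  set q : ℕ := ⌈(c.length : ℝ) / (η * m)⌉₊ with hq
  have hq0 : 0 < q := Nat.ceil_pos.mpr (by positivity)
  have hcq : (c.length : ℝ) ≤ η * (q * m) := by
    have := Nat.le_ceil ((c.length : ℝ) / (η * m))
    rw [← hq, div_le_iff₀ hηm] at this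
    linarith
  have hqc : η * (q * m) ≤ 2 * c.length := by
    have := Nat.ceil_lt_add_one (a := (c.length : ℝ) / (η * m)) (by positivity)
    rw [← hq, ← sub_lt_iff_lt_add, lt_div_iff₀ hηm] at this
    linarith
  -- the itineraries
  have hblock : ∀ (ω : ℕ → D) (k : ℕ), (ω k : List α) ∈ G ∧ (ω k : List α).length = m :=
    fun ω k => ⟨(hD _ (ω k).2).1, (hD _ (ω k).2).2.1⟩
  have hit := fun ω : ℕ → D => exists_itinerary hXcl hG hspec hc (OscAt q) (hblock ω)
  choose x T hxT using hit
  have hirr : ∀ ω, x ω ∈ irregular (subShift X) ψ := fun ω =>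
    (hxT ω).mem_irregular hX hq0 hm (fun k => (hblock ω k).2) hB hC hψ hH
      (fun k => (hD _ (ω k).2).2.2) hδ hδ' hη0 hη hδκ hτ hτB (by exact_mod_cast hc0) hcq hqc hcγ
  -- the product measure
  set Z := ∑ d ∈ D, Real.exp (F d) with hZ
  have hZ0 : 0 < Z := (Real.exp_pos _).trans_le hDsum
  let _ : MeasurableSpace D := ⊤
  have hsum : ∑ d : D, ENNReal.ofReal (Real.exp (F d) / Z) = 1 := by
    rw [← ENNReal.ofReal_sum_of_nonneg fun d _ => by positivity, ← Finset.sum_div,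
      Finset.sum_coe_sort D fun d => Real.exp (F d), div_self hZ0.ne', ENNReal.ofReal_one]
  let p : PMF D := PMF.ofFintype _ hsum
  have hp : ∀ d, p.toMeasure {d} = ENNReal.ofReal (Real.exp (F d) / Z) := fun d => by
    rw [PMF.toMeasure_apply_singleton _ _ (measurableSet_singleton _)]
    rfl
  set K := (4 * B + 1) * c.length + 2 * C + (B + |t₂|) * (2 * c.length + 2 * m) with hK
  refine ⟨2 * c.length, ?_⟩
  have hmass := ofReal_exp_neg_le_Mcal (Measure.infinitePi fun _ : ℕ => p.toMeasure)
    (f := φ) (t := t) (K := K) (N := 2 * c.length) hirr ?_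
  · intro h0
    rw [h0] at hmass
    simp only [nonpos_iff_eq_zero, ENNReal.ofReal_eq_zero] at hmass
    exact absurd hmass (not_le.mpr (Real.exp_pos _))
  intro w hw
  set n := w.length with hn
  set k := ⌊((n : ℝ) - 2 * c.length) / (m * (1 + 2 * η))⌋₊ with hk
  have hτB' : 2 * τ * B + 3 * C ≤ η * m := by
    have h1 : δ * m ≤ η * m := by gcongr
    have h2 : 0 ≤ 2 * τ * |γ| := by positivity
    linarith
  have hτ' : 2 * τ ≤ η * m := hτ.trans (by gcongr)
  have hest := fun ω : ℕ → D => (hxT ω).sum_le_birkhoff hX hq0 (fun k => (hblock ω k).2) hm hB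
    hC hφ hF (hG hc) hδ.le hδη hη hτ' hτB' hcq ht hw.le hk
  rw [← hK] at hest
  set s := sSup (birkhoff (subShift X) φ n '' (Subtype.val ⁻¹' cylinder w)) with hs
  have hbdd : BddAbove (birkhoff (subShift X) φ n '' (Subtype.val ⁻¹' cylinder w)) := by
    refine ⟨B * n, ?_⟩
    rintro _ ⟨y, -, rfl⟩
    exact (abs_le.mp (abs_birkhoff_le (subShift X) hφ n y)).2
  have hlab : ∀ (ω : ℕ → D) (i : ℕ), T ω (i + 1) - T ω i - m -
      (if OscAt q i then c.length else 0) < 2 * τ + 1 := fun ω i => by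
    have := (hxT ω).upper i
    omega
  refine (infinitePi_le_pow_mul p.toMeasure _ (k := k) (R := 2 * τ + 1)
    (fun ω i => ⟨_, hlab ω i⟩)
    (K := ENNReal.ofReal (Real.exp (K + (-t * n + s) - k * (η * m)))) ?_ ?_).trans ?_
  · intro ω hω ω' hω' hl i hi
    have hT := (hxT ω).time_eq (hxT ω') (k := k) fun j hj => by
      have := congrFun hl ⟨j, hj⟩
      simpa using this
    refine Subtype.ext ((hxT ω).block_eq (hxT ω') (fun k => (hblock ω k).2)
      (fun k => (hblock ω' k).2) (n := n) (fun j hj => ?_) hT (hest ω).1 i hi)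
    rw [mem_cylinder_iff.mp hω j hj, mem_cylinder_iff.mp hω' j hj]
  · intro ω hω
    simp only [hp]
    rw [← ENNReal.ofReal_prod_of_nonneg fun i _ => by positivity]
    refine ENNReal.ofReal_le_ofReal ?_
    rw [Finset.prod_div_distrib, ← Real.exp_sum, Finset.prod_const, Finset.card_range,
      div_le_iff₀ (by positivity)]
    have h1 := (hest ω).2
    have h2 : birkhoff (subShift X) φ n (x ω) ≤ s := le_csSup hbdd ⟨_, hω, rfl⟩
    calc Real.exp (∑ i ∈ Finset.range k, F (ω i))
        ≤ Real.exp (K + (-t * n + s) - k * (η * m) + k * (t₂ * m)) :=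
          Real.exp_le_exp.mpr (by linarith)
      _ = Real.exp (K + (-t * n + s) - k * (η * m)) * Real.exp (t₂ * m) ^ k := by
          rw [Real.exp_add, ← Real.exp_nat_mul]
      _ ≤ _ := by gcongr
  · have h1 : ((2 * τ + 1 : ℕ) : ℝ≥0∞) ^ k ≤ ENNReal.ofReal (Real.exp (k * (η * m))) := by
      rw [← ENNReal.ofReal_natCast, ← ENNReal.ofReal_pow (by positivity), Real.exp_nat_mul]
      refine ENNReal.ofReal_le_ofReal ?_
      push_cast
      gcongr
    refine (mul_le_mul' h1 le_rfl).trans_eq ?_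
    rw [← ENNReal.ofReal_mul (Real.exp_pos _).le, ← Real.exp_add]
    congr 2
    ring

/-! ### Pressure -/

lemma Mcal_mono {α : Type} {X : Set (ℕ → α)} {f : X → ℝ} {Z Z' : Set X} (h : Z ⊆ Z') (t : ℝ)
    (N : ℕ) : Mcal X f Z t N ≤ Mcal X f Z' t N :=
  iInf_mono fun _ => iInf_mono fun _ => iInf_mono fun _ =>
    le_iInf fun hc => iInf_le_of_le (h.trans hc) le_rfl

lemma McalLim_eq_zero {α : Type} {X : Set (ℕ → α)} {f : X → ℝ} {Z : Set X} {t : ℝ} :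
    McalLim X f Z t = 0 ↔ ∀ N, Mcal X f Z t N = 0 := by
  simp [McalLim]

lemma Mcal_univ_le_sum {α : Type} [Finite α] {X : Set (ℕ → α)} {f : X → ℝ} {t : ℝ} {N n : ℕ}
    (hn : N < n) : Mcal X f univ t N ≤ ENNReal.ofReal (Real.exp (-t * n) * ∑ w ∈ words X n,
      Real.exp (sSup (birkhoff (subShift X) f n '' (Subtype.val ⁻¹' cylinder w)))) := by
  unfold Mcal
  refine iInf_le_of_le ((words X n : Finset (List α)) : Set (List α)) ?_
  refine iInf_le_of_le (Finset.countable_toSet _) ?_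
  refine iInf_le_of_le (fun w hw => ?_) ?_
  · rwa [(mem_words.mp hw).2]
  refine iInf_le_of_le (fun x _ => ?_) (le_of_eq ?_)
  · refine mem_iUnion₂.mpr ⟨prefixWord x.val n, ?_, mem_cylinder_prefixWord _ _⟩
    exact mem_words.mpr ⟨prefixWord_mem_language _ _, length_prefixWord _ _⟩
  · rw [Finset.mul_sum, ENNReal.ofReal_sum_of_nonneg fun _ _ => by positivity,
      Finset.tsum_subtype' (words X n) fun w : List α => ENNReal.ofReal (Real.exp (-t * w.length +
        sSup (birkhoff (subShift X) f w.length '' (Subtype.val ⁻¹' cylinder w))))]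
    refine Finset.sum_congr rfl fun w hw => ?_
    rw [(mem_words.mp hw).2, Real.exp_add]

lemma sSup_birkhoff_le {α : Type} {X : Set (ℕ → α)} {f : X → ℝ} {w : List α}
    (hw : w ∈ language X) {b : ℝ}
    (hb : ∀ x : X, x.val ∈ cylinder w → birkhoff (subShift X) f w.length x ≤ b) :
    sSup (birkhoff (subShift X) f w.length '' (Subtype.val ⁻¹' cylinder w)) ≤ b := by
  obtain ⟨x, hx, hxX⟩ := hw
  refine csSup_le ⟨_, ⟨x, hxX⟩, hx, rfl⟩ ?_
  rintro _ ⟨y, hy, rfl⟩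
  exact hb y hy

lemma card_words_le {α : Type} [Fintype α] (X : Set (ℕ → α)) (n : ℕ) :
    (words X n).card ≤ Fintype.card α ^ n := by
  have hsub : words X n ⊆ Finset.univ.image fun u : Fin n → α => List.ofFn u := by
    intro w hw
    obtain ⟨-, rfl⟩ := mem_words.mp hw
    exact Finset.mem_image.mpr ⟨w.get, Finset.mem_univ _, List.ofFn_get w⟩
  refine (Finset.card_le_card hsub).trans (Finset.card_image_le.trans ?_)
  simp

lemma exists_McalLim_univ_eq_zero {α : Type} [Fintype α] {X : Set (ℕ → α)} {f : X → ℝ} {B : ℝ}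
    (hf : ∀ x, |f x| ≤ B) : ∃ t, McalLim X f univ t = 0 := by
  refine ⟨B + Fintype.card α + 1, McalLim_eq_zero.mpr fun N => ?_⟩
  have hle : ∀ n > N, Mcal X f univ (B + Fintype.card α + 1) N ≤
      ENNReal.ofReal (Real.exp (-n)) := by
    intro n hn
    refine (Mcal_univ_le_sum hn).trans (ENNReal.ofReal_le_ofReal ?_)
    have h1 : ∑ w ∈ words X n, Real.exp (sSup (birkhoff (subShift X) f n ''
        (Subtype.val ⁻¹' cylinder w))) ≤ ∑ _w ∈ words X n, Real.exp (B * n) := by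
      refine Finset.sum_le_sum fun w hw => Real.exp_le_exp.mpr ?_
      obtain ⟨hw', rfl⟩ := mem_words.mp hw
      exact sSup_birkhoff_le hw' fun x _ =>
        (abs_le.mp (abs_birkhoff_le (subShift X) hf w.length x)).2
    have h2 : ((words X n).card : ℝ) ≤ Real.exp (Fintype.card α * n) := by
      calc ((words X n).card : ℝ) ≤ (Fintype.card α : ℝ) ^ n := by exact_mod_cast card_words_le X n
        _ ≤ Real.exp (Fintype.card α) ^ n := by
          gcongr
          linarith [Real.add_one_le_exp (Fintype.card α : ℝ)]
        _ = _ := by rw [← Real.exp_nat_mul, mul_comm]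
    rw [Finset.sum_const, nsmul_eq_mul] at h1
    calc _ ≤ Real.exp (-(B + Fintype.card α + 1) * n) *
          (Real.exp (Fintype.card α * n) * Real.exp (B * n)) := by
          gcongr
          exact h1.trans (by gcongr)
      _ = _ := by rw [← Real.exp_add, ← Real.exp_add]; congr 1; ring
  have hlim : Tendsto (fun n : ℕ => ENNReal.ofReal (Real.exp (-n))) atTop (𝓝 0) := by
    rw [← ENNReal.ofReal_zero]
    exact (ENNReal.continuous_ofReal.tendsto 0).comp
      (Real.tendsto_exp_neg_atTop_nhds_zero.comp tendsto_natCast_atTop_atTop)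
  exact le_antisymm (ge_of_tendsto hlim ((eventually_gt_atTop N).mono hle)) zero_le

lemma neg_le_of_McalLim_eq_zero {α : Type} {X : Set (ℕ → α)} {f : X → ℝ} {Z : Set X}
    (hZ : Z.Nonempty) {B : ℝ} (hf : ∀ x, |f x| ≤ B) {t : ℝ}
    (ht : McalLim X f Z t = 0) : -B ≤ t := by
  by_contra! hlt
  have h1 : 1 ≤ Mcal X f Z t 0 := by
    refine le_iInf fun S => le_iInf fun _ => le_iInf fun _ => le_iInf fun hcov => ?_
    obtain ⟨x, hx⟩ := hZ
    obtain ⟨w, hw, hxw⟩ := mem_iUnion₂.mp (hcov hx)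
    refine le_trans ?_ (ENNReal.le_tsum (⟨w, hw⟩ : S))
    rw [ENNReal.one_le_ofReal, Real.one_le_exp_iff]
    have h2 := (abs_le.mp (abs_birkhoff_le (subShift X) hf w.length x)).1
    have h3 : birkhoff (subShift X) f w.length x ≤
        sSup (birkhoff (subShift X) f w.length '' (Subtype.val ⁻¹' cylinder w)) := by
      refine le_csSup ⟨B * w.length, ?_⟩ ⟨x, hxw, rfl⟩
      rintro _ ⟨y, -, rfl⟩
      exact (abs_le.mp (abs_birkhoff_le (subShift X) hf w.length y)).2
    have h4 : t * w.length ≤ -B * w.length := by gcongr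
    linarith
  rw [McalLim_eq_zero.mp ht 0] at h1
  simp at h1

/-- Below the pressure, the partition sums over words grow at the corresponding rate. -/
lemma eventually_le_sum_words {α : Type} [Finite α] {X : Set (ℕ → α)} {f : X → ℝ} {δ C t : ℝ}
    {F : List α → ℝ} (hF : WordApprox X f δ C F) (ht : McalLim X f univ t ≠ 0) :
    ∃ c > 0, ∀ᶠ n : ℕ in atTop,
      c * Real.exp ((t - δ) * n) ≤ ∑ w ∈ words X n, Real.exp (F w) := by
  rw [Ne, McalLim_eq_zero, not_forall] at ht
  obtain ⟨N, hN⟩ := ht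
  have hfin : Mcal X f univ t N ≠ ⊤ :=
    ne_top_of_le_ne_top ENNReal.ofReal_ne_top (Mcal_univ_le_sum (Nat.lt_succ_self N))
  refine ⟨(Mcal X f univ t N).toReal * Real.exp (-C),
    mul_pos (ENNReal.toReal_pos hN hfin) (Real.exp_pos _), ?_⟩
  filter_upwards [eventually_gt_atTop N] with n hn
  have h1 := ENNReal.toReal_le_of_le_ofReal (by positivity) (Mcal_univ_le_sum (f := f) (t := t) hn)
  have h2 : ∑ w ∈ words X n, Real.exp (sSup (birkhoff (subShift X) f n ''
      (Subtype.val ⁻¹' cylinder w))) ≤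
      Real.exp (δ * n + C) * ∑ w ∈ words X n, Real.exp (F w) := by
    rw [Finset.mul_sum]
    refine Finset.sum_le_sum fun w hw => ?_
    rw [← Real.exp_add]
    refine Real.exp_le_exp.mpr ?_
    obtain ⟨hw', rfl⟩ := mem_words.mp hw
    exact sSup_birkhoff_le hw' fun x hx => by linarith [(abs_le.mp (hF.approx w x hx)).2]
  calc _ ≤ (Real.exp (-t * n) * (Real.exp (δ * n + C) * ∑ w ∈ words X n, Real.exp (F w))) *
        Real.exp (-C) * Real.exp ((t - δ) * n) := by
        gcongr
        exact h1.trans (by gcongr)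
    _ = Real.exp (-t * n + (δ * n + C) + -C + (t - δ) * n) *
        ∑ w ∈ words X n, Real.exp (F w) := by
        simp only [Real.exp_add]; ring
    _ = _ := by
        rw [show -t * n + (δ * n + C) + -C + (t - δ) * n = 0 by ring, Real.exp_zero, one_mul]

/-! ### The dichotomy -/

lemma birkAvg_neg {Y : Type*} (σ : Y → Y) (f : Y → ℝ) (n : ℕ) (y : Y) :
    birkAvg σ (-f) n y = -birkAvg σ f n y := by
  simp [birkAvg, birkhoff_neg]

lemma abs_birkAvg_le {Y : Type*} (σ : Y → Y) {f : Y → ℝ} {B : ℝ} (hB0 : 0 ≤ B)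
    (hB : ∀ y, |f y| ≤ B) (n : ℕ) (y : Y) : |birkAvg σ f n y| ≤ B := by
  rcases n.eq_zero_or_pos with rfl | hn
  · simpa [birkAvg, birkhoff] using hB0
  · have hn' : (0 : ℝ) < n := by exact_mod_cast hn
    rw [birkAvg, abs_mul, abs_of_pos (inv_pos.mpr hn'), inv_mul_le_iff₀ hn', mul_comm]
    exact abs_birkhoff_le σ hB n y

/-- The Birkhoff averages of a bounded function at an irregular point oscillate. -/
lemma exists_oscillation_of_mem_irregular {Y : Type*} {σ : Y → Y} {f : Y → ℝ} {B : ℝ}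
    (hB0 : 0 ≤ B) (hB : ∀ y, |f y| ≤ B) {x : Y} (hx : x ∈ irregular σ f) :
    ∃ a b : ℝ, a < b ∧ (∃ᶠ n in atTop, birkAvg σ f n x < a) ∧
      ∃ᶠ n in atTop, b < birkAvg σ f n x := by
  by_contra! H
  refine hx (tendsto_of_no_upcrossings dense_univ ?_ ?_ ?_)
  · rintro a - b - hab ⟨h1, h2⟩
    exact h2 ((H a b hab h1).mono fun n hn => not_lt.mpr hn)
  · exact isBoundedUnder_of ⟨B, fun n => (abs_le.mp (abs_birkAvg_le σ hB0 hB n x)).2⟩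
  · exact isBoundedUnder_of ⟨-B, fun n => (abs_le.mp (abs_birkAvg_le σ hB0 hB n x)).1⟩

/-- Good words on which the averages of `ψ` stay away from a prescribed value. -/
lemma exists_good_word_far {α : Type} {X : Set (ℕ → α)} {G : Set (List α)} {g : ℕ → ℕ}
    (hg : MistakeFun g) (happ : ∀ w ∈ language X, ∃ v ∈ G, editDist v w ≤ g w.length)
    {f : X → ℝ} {ε C : ℝ} {F : List α → ℝ} (hF : WordApprox X f ε C F) (hC : 0 ≤ C)
    {a b κ : ℝ} (hκ : 0 < κ) (hεκ : ε < 2 * κ) (hab : 8 * κ = b - a) {x : X}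
    (ha : ∃ᶠ n in atTop, birkAvg (subShift X) f n x < a)
    (hb : ∃ᶠ n in atTop, b < birkAvg (subShift X) f n x) (γ : ℝ) (M : ℕ) :
    ∃ c ∈ G, M ≤ c.length ∧ κ * c.length ≤ |F c - γ * c.length| := by
  rcases le_total ((a + b) / 2) γ with hγ | hγ
  · obtain ⟨c, hc, hM, hFc⟩ := exists_good_word_lt hg happ hF hC hεκ (by positivity) ha M
    refine ⟨c, hc, hM, ?_⟩
    rw [abs_sub_comm]
    refine le_trans ?_ (le_abs_self _)
    have : 0 ≤ (γ - a - 3 * κ) * c.length := mul_nonneg (by linarith) (Nat.cast_nonneg _)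
    linarith
  · have hb' : ∃ᶠ n in atTop, birkAvg (subShift X) (-f) n x < -b :=
      hb.mono fun n hn => by rw [birkAvg_neg]; linarith
    obtain ⟨c, hc, hM, hFc⟩ :=
      exists_good_word_lt hg happ hF.neg hC hεκ (by positivity) hb' M
    refine ⟨c, hc, hM, le_trans ?_ (le_abs_self _)⟩
    rw [Pi.neg_apply] at hFc
    have : 0 ≤ (b - γ - 3 * κ) * c.length := mul_nonneg (by linarith) (Nat.cast_nonneg _)
    linarith

/-- If the irregular set is nonempty, it is not null for any exponent below one for which the
whole space is not null. -/
lemma McalLim_irregular_ne_zero {α : Type} [Finite α] [TopologicalSpace α]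
    [DiscreteTopology α] {X : Set (ℕ → α)} (hXcl : IsClosed X) (hX : MapsTo shift X X)
    {G : Set (List α)} (hG : G ⊆ language X) (hspec : HasSpecW (language X) G)
    (happ : EditApproachable (language X) G) {φ ψ : X → ℝ} (hφ : Continuous φ)
    (hψ : Continuous ψ) (hne : (irregular (subShift X) ψ).Nonempty) {t t₁ : ℝ} (ht : t < t₁)
    (ht₁ : McalLim X φ univ t₁ ≠ 0) : McalLim X φ (irregular (subShift X) ψ) t ≠ 0 := by
  obtain ⟨τ, hτ⟩ := hspec
  have hspec' : ∀ v ∈ G, ∀ w ∈ G, ∃ u : List α, u.length ≤ τ ∧ v ++ u ++ w ∈ G :=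
    fun v hv w hw => let ⟨u, _, hu⟩ := hτ v hv w hw; ⟨u, hu⟩
  obtain ⟨g, hg, happ⟩ := happ
  obtain ⟨B₁, hB₁, hφB₁⟩ := exists_abs_le hXcl hφ
  obtain ⟨B₂, hB₂, hψB₂⟩ := exists_abs_le hXcl hψ
  obtain ⟨B, hB, hφB, hψB⟩ : ∃ B, 0 ≤ B ∧ (∀ y, |φ y| ≤ B) ∧ ∀ y, |ψ y| ≤ B :=
    ⟨max B₁ B₂, hB₁.trans (le_max_left _ _), fun y => (hφB₁ y).trans (le_max_left _ _),
      fun y => (hψB₂ y).trans (le_max_right _ _)⟩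
  obtain ⟨x, hx⟩ := hne
  obtain ⟨a, b, hab, ha, hb⟩ := exists_oscillation_of_mem_irregular hB hψB hx
  set t₂ : ℝ := (t + t₁) / 2 with ht₂
  set η : ℝ := min (1 / 8) ((t₂ - t) / (3 * B + 4 + 2 * |t₂|)) with hη
  have hden : 0 < 3 * B + 4 + 2 * |t₂| := by positivity
  have hη0 : 0 < η := lt_min (by norm_num) (div_pos (by linarith) hden)
  have hηt : (3 * B + 4 + 2 * |t₂|) * η ≤ t₂ - t := by
    rw [← le_div_iff₀' hden]
    exact min_le_right _ _
  have hη8 : η ≤ 1 / 8 := min_le_left _ _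
  obtain ⟨κ, hκ, hκ0⟩ : ∃ κ : ℝ, 8 * κ = b - a ∧ 0 < κ :=
    ⟨(b - a) / 8, by ring, by linarith⟩
  obtain ⟨δ, hδ, hδ', hδη, hδκ, hδt⟩ : ∃ δ : ℝ, 0 < δ ∧ δ ≤ 1 / 32 ∧ δ ≤ η ∧
      200 * δ ≤ κ * η ∧ 2 * δ ≤ t₁ - t₂ := by
    refine ⟨min (min (1 / 32) η) (min (κ * η / 200) ((t₁ - t₂) / 2)),
      lt_min (lt_min (by norm_num) hη0) (lt_min (by positivity) (by linarith)),
      (min_le_left _ _).trans (min_le_left _ _), (min_le_left _ _).trans (min_le_right _ _), ?_, ?_⟩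
    · have := (min_le_right (min (1 / 32) η) (min (κ * η / 200) ((t₁ - t₂) / 2))).trans
        (min_le_left _ _)
      linarith
    · have := (min_le_right (min (1 / 32) η) (min (κ * η / 200) ((t₁ - t₂) / 2))).trans
        (min_le_right _ _)
      linarith
  have hδκ' : δ < 2 * κ := by nlinarith
  obtain ⟨C₁, F, hC₁, hF⟩ := exists_wordApprox hXcl hX hφ hδ
  obtain ⟨C₂, H, hC₂, hH⟩ := exists_wordApprox hXcl hX hψ hδ
  replace hF := hF.mono (le_max_left C₁ C₂)
  replace hH := hH.mono (le_max_right C₁ C₂)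
  have hC : 0 ≤ max C₁ C₂ := hC₁.trans (le_max_left _ _)
  set C := max C₁ C₂
  obtain ⟨c₀, hc₀, hsum⟩ := eventually_le_sum_words hF ht₁
  obtain ⟨M, hM⟩ : ∃ M : ℕ, max (max (1 : ℝ) (2 * τ / δ))
      (max ((2 * τ * (B + (B + δ + C + 2 * δ)) + 3 * C) / δ) (Real.log (2 * τ + 1) / η)) ≤ M :=
    ⟨_, Nat.le_ceil _⟩
  obtain ⟨m, γ, D, hMm, hγ, hD, hDsum⟩ := exists_good_blocks hG hg happ
    (B := B + δ) hC hF.lipschitz (fun v hv => hH.abs_le hψB hv) hc₀ hsum hδ M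
  replace hM := hM.trans (Nat.cast_le (α := ℝ).mpr hMm)
  simp only [max_le_iff] at hM
  obtain ⟨⟨hm1, hm2⟩, hm3, hm4⟩ := hM
  rw [div_le_iff₀' hδ] at hm2 hm3
  rw [div_le_iff₀' hη0, Real.log_le_iff_le_exp (by positivity)] at hm4
  obtain ⟨c, hcG, hmc, hcγ⟩ :=
    exists_good_word_far hg happ hH hC hκ0 hδκ' hκ ha hb γ ⌈η * m⌉₊
  have hτγ : 2 * τ * (B + |γ|) + 3 * C ≤ δ * m := by
    refine le_trans ?_ hm3
    gcongr
  have hDsum' : Real.exp (t₂ * m) ≤ ∑ d ∈ D, Real.exp (F d) := by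
    refine le_trans (Real.exp_le_exp.mpr ?_) hDsum
    gcongr
    linarith
  obtain ⟨N, hN⟩ := exists_Mcal_irregular_ne_zero hXcl hX hG hspec' hB hC hφB hψB hF hH
    (by exact_mod_cast hm1) hD hDsum' hδ hδ' hδη hη8 hδκ hm2 hτγ hm4 hηt hcG
    (Nat.ceil_le.mp hmc) hcγ
  exact fun h => hN (McalLim_eq_zero.mp h N)

/-- the irregular set is either empty or has full topological pressure. -/
theorem statement_1 {A : Type} [Fintype A] [DecidableEq A] [TopologicalSpace A]
    [DiscreteTopology A] [MeasurableSpace A] [BorelSpace A]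
    (X : Set (ℕ → A)) (hXcl : IsClosed X) (hXinv : Set.MapsTo shift X X)
    (φ : ↥X → ℝ) (hφ : Continuous φ)
    (G : Set (List A)) (hG : G ⊆ language X)
    (hspec : HasSpecW (language X) G) (happ : EditApproachable (language X) G)
    (ψ : ↥X → ℝ) (hψ : Continuous ψ) :
    irregular (subShift X) ψ = ∅ ∨
      pressure X φ (irregular (subShift X) ψ) = pressure X φ Set.univ := by
  rcases (irregular (subShift X) ψ).eq_empty_or_nonempty with hne | hne
  · exact Or.inl hne
  right
  obtain ⟨B, -, hφB⟩ := exists_abs_le hXcl hφ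
  have hbdd : ∀ Z : Set X, Z.Nonempty → BddBelow {t : ℝ | McalLim X φ Z t = 0} :=
    fun Z hZ => ⟨-B, fun t ht => neg_le_of_McalLim_eq_zero hZ hφB ht⟩
  obtain ⟨t₀, ht₀⟩ := exists_McalLim_univ_eq_zero hφB
  have hsub : {t : ℝ | McalLim X φ univ t = 0} ⊆
      {t : ℝ | McalLim X φ (irregular (subShift X) ψ) t = 0} := by
    intro t ht
    exact McalLim_eq_zero.mpr fun N =>
      le_antisymm ((Mcal_mono (subset_univ _) t N).trans (McalLim_eq_zero.mp ht N).le) zero_le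
  refine le_antisymm (csInf_le_csInf (hbdd _ hne) ⟨t₀, ht₀⟩ hsub)
    (le_csInf ⟨t₀, hsub ht₀⟩ fun t ht => ?_)
  by_contra! hlt
  obtain ⟨t₁, htt₁, ht₁⟩ := exists_between hlt
  exact McalLim_irregular_ne_zero hXcl hXinv hG hspec happ hφ hψ hne htt₁
    (notMem_of_lt_csInf (s := {t : ℝ | McalLim X φ univ t = 0}) ht₁
      (hbdd _ (hne.mono (subset_univ _)))) ht

end Paper
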